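/- Let k be a field, c ∈ k^×, and let σ be the k-automorphism of k(x1,x2,x3) defined by σ(x1) = x2, σ(x2) = x3, σ(x3) = c/(x1·x2·x3) (so σ has order 4). Then k(x1,x2,x3)^⟨σ⟩ is k-rational if and only if at least one of the following holds: (i) char k = 2; (ii) c is a square in k; (iii) −4c is a fourth power in k; (iv) −1 is a square in k. Moreover, if k(x1,x2,x3)^⟨σ⟩ is not k-rational, then it is not retract k-rational. -/

import Mathlib

open MvPolynomial

noncomputable section

/-- A field extension `K` of `k` is `k`-rational if it is isomorphic, as a `k`-algebra,
to a rational function field `k(x₁, …, xₙ)` in finitely many variables. -/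
def IsRational (k K : Type*) [Field k] [Field K] [Algebra k K] : Prop :=
  ∃ n : ℕ, Nonempty (K ≃ₐ[k] FractionRing (MvPolynomial (Fin n) k))

/-- A field extension `K` of `k` is retract `k`-rational if there is a `k`-subalgebra `A` of `K`
whose fraction field is `K`, together with a nonzero polynomial `f ∈ k[x₁,…,xₙ]` and `k`-algebra
homomorphisms `φ : A → k[x₁,…,xₙ][1/f]` and `ψ : k[x₁,…,xₙ][1/f] → A` with `ψ ∘ φ = id_A`. -/
def IsRetractRational (k K : Type*) [Field k] [Field K] [Algebra k K] : Prop :=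
  ∃ A : Subalgebra k K, IsFractionRing A K ∧
    ∃ (n : ℕ) (f : MvPolynomial (Fin n) k), f ≠ 0 ∧
      ∃ (φ : A →ₐ[k] Localization.Away f) (ψ : Localization.Away f →ₐ[k] A),
        ψ.comp φ = AlgHom.id k A

/-- `σ` is a `k`-automorphism of the rational function field `M = k(x₁, x₂, x₃)` permuting
`x₁, x₂, x₃, x₄` cyclically, where `x₁ x₂ x₃ x₄ = c`. -/
structure IsMonomialC4 {k M : Type*} [Field k] [Field M] [Algebra k M] (c : k) (σ : M ≃ₐ[k] M)
    (x₁ x₂ x₃ x₄ : M) : Prop where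
  indep : AlgebraicIndependent k ![x₁, x₂, x₃]
  gen : IntermediateField.adjoin k (Set.range ![x₁, x₂, x₃]) = ⊤
  map₁ : σ x₁ = x₂
  map₂ : σ x₂ = x₃
  map₃ : σ x₃ = x₄
  map₄ : σ x₄ = x₁
  prod : x₁ * x₂ * x₃ * x₄ = algebraMap k M c

section Generators

variable {k M : Type*} [Field k] [Field M] [Algebra k M]

theorem trdeg_eq_three_of_indep {u : Fin 3 → M} (hu : AlgebraicIndependent k u)
    (hgen : IntermediateField.adjoin k (Set.range u) = ⊤) : Algebra.trdeg k M = 3 := by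
  have : IsTranscendenceBasis k u := by
    rw [hu.isTranscendenceBasis_iff_isAlgebraic, ← IntermediateField.isAlgebraic_adjoin_iff_top,
      hgen, Algebra.isAlgebraic_iff_isIntegral]
    exact Algebra.isIntegral_of_surjective IntermediateField.topEquiv.surjective
  simpa using this.lift_cardinalMk_eq_trdeg.symm

theorem algebraicIndependent_of_isAlgebraic_adjoin (htr : Algebra.trdeg k M = 3) {u : Fin 3 → M}
    [Algebra.IsAlgebraic (IntermediateField.adjoin k (Set.range u)) M] :
    AlgebraicIndependent k u := by
  have : Algebra.IsAlgebraic (Algebra.adjoin k (Set.range u)) M :=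
    IntermediateField.isAlgebraic_adjoin_iff_top.1 inferInstance
  have : Module.IsTorsionFree k M := inferInstance
  refine (Algebra.IsAlgebraic.isTranscendenceBasis_of_lift_le_trdeg_of_finite k u ?_).1
  simp [htr]

theorem finrank_le_of_root {E : Type*} [Field E] [Algebra E M] {r : M} {p : Polynomial E} {n : ℕ}
    (hp : p ≠ 0) (hr : Polynomial.aeval r p = 0) (hn : p.natDegree ≤ n)
    (hgen : IntermediateField.adjoin E {r} = ⊤) :
    FiniteDimensional E M ∧ Module.finrank E M ≤ n := by
  have hr_int : IsIntegral E r := (IsAlgebraic.isIntegral ⟨p, hp, hr⟩)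
  have h1 := IntermediateField.adjoin.finrank hr_int
  have h2 := IntermediateField.adjoin.finiteDimensional hr_int
  rw [hgen] at h1 h2
  rw [IntermediateField.finrank_top'] at h1
  refine ⟨Module.Finite.equiv (IntermediateField.topEquiv (F := E) (E := M)).toLinearEquiv, ?_⟩
  rw [h1]
  exact (Polynomial.natDegree_le_of_dvd (minpoly.dvd E r hr) hp).trans hn

theorem IntermediateField.adjoin_singleton_eq_top_of_forall (L : IntermediateField k M) {r : M}
    (h : ∀ K : IntermediateField k M, L ≤ K → r ∈ K → K = ⊤) :
    IntermediateField.adjoin L {r} = ⊤ := by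
  have := h ((IntermediateField.adjoin L {r}).restrictScalars k) (fun x hx => ?_) ?_
  · rw [eq_top_iff]
    intro x _
    rw [← IntermediateField.mem_restrictScalars k, this]
    trivial
  · exact (IntermediateField.adjoin L {r}).algebraMap_mem ⟨x, hx⟩
  · exact IntermediateField.mem_adjoin_simple_self L r

theorem finrank_le_mul_of_tower (L E M : Type*) [Field L] [Field E] [Field M] [Algebra L E]
    [Algebra E M] [Algebra L M] [IsScalarTower L E M] {m n : ℕ}
    (h₁ : FiniteDimensional L E) (h₂ : Module.finrank L E ≤ m)
    (h₃ : FiniteDimensional E M) (h₄ : Module.finrank E M ≤ n) :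
    FiniteDimensional L M ∧ Module.finrank L M ≤ m * n := by
  refine ⟨FiniteDimensional.trans L E M, ?_⟩
  rw [← Module.finrank_mul_finrank L E M]
  exact Nat.mul_le_mul h₂ h₄

theorem finrank_le_four_of_quadratic_tower (L : IntermediateField k M) {s t a b a' b' : M}
    (ha : a ∈ L) (hb : b ∈ L) (hs : s ^ 2 = a * s + b)
    (ha' : ∀ K : IntermediateField k M, L ≤ K → s ∈ K → a' ∈ K)
    (hb' : ∀ K : IntermediateField k M, L ≤ K → s ∈ K → b' ∈ K)
    (ht : t ^ 2 = a' * t + b')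
    (hgen : ∀ K : IntermediateField k M, L ≤ K → s ∈ K → t ∈ K → K = ⊤) :
    FiniteDimensional L M ∧ Module.finrank L M ≤ 4 := by
  let E := IntermediateField.adjoin L {s}
  have hLE : L ≤ E.restrictScalars k := fun x hx => E.algebraMap_mem ⟨x, hx⟩
  have hsE : s ∈ E.restrictScalars k := IntermediateField.mem_adjoin_simple_self L s
  have hdeg : ∀ {A : Type _} [Field A] (α β : A),
      (Polynomial.X ^ 2 - (Polynomial.C α * Polynomial.X + Polynomial.C β)).natDegree = 2 := by
    intro A _ α β; compute_degree!
  have hne : ∀ {A : Type _} [Field A] (α β : A),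
      (Polynomial.X ^ 2 - (Polynomial.C α * Polynomial.X + Polynomial.C β)) ≠ 0 := by
    intro A _ α β h
    have := hdeg α β
    simp [h] at this
  have h1 : FiniteDimensional (E.restrictScalars k) M ∧
      Module.finrank (E.restrictScalars k) M ≤ 2 := by
    refine finrank_le_of_root (r := t) (hne ⟨a', ha' _ hLE hsE⟩ ⟨b', hb' _ hLE hsE⟩) ?_
      (hdeg _ _).le ?_
    · simp [ht, IntermediateField.algebraMap_apply]
    · exact IntermediateField.adjoin_singleton_eq_top_of_forall _
        fun K hK ht => hgen K (hLE.trans hK) (hK hsE) ht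
  have hr_int : IsIntegral L s := IsAlgebraic.isIntegral
      ⟨_, hne ⟨a, ha⟩ ⟨b, hb⟩, by simp [hs, IntermediateField.algebraMap_apply]⟩
  have h2 : FiniteDimensional L E := IntermediateField.adjoin.finiteDimensional hr_int
  have h3 : Module.finrank L E ≤ 2 := by
    rw [IntermediateField.adjoin.finrank hr_int, ← hdeg (⟨a, ha⟩ : L) ⟨b, hb⟩]
    refine Polynomial.natDegree_le_of_dvd (minpoly.dvd _ _ ?_) (hne _ _)
    simp [hs, IntermediateField.algebraMap_apply]
  have h4 : FiniteDimensional E M := h1.1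
  have h5 : Module.finrank E M ≤ 2 := h1.2
  exact finrank_le_mul_of_tower L E M h2 h3 h4 h5

end Generators

namespace IsMonomialC4

variable {k M : Type*} [Field k] [Field M] [Algebra k M] {c : k} {σ : M ≃ₐ[k] M}
  {x₁ x₂ x₃ x₄ : M}

theorem aeval_ne_zero (h : IsMonomialC4 c σ x₁ x₂ x₃ x₄) {p : MvPolynomial (Fin 3) k}
    (hp : p ≠ 0) : aeval ![x₁, x₂, x₃] p ≠ 0 := by
  intro h0
  exact hp (h.indep (by simpa using h0))

theorem aeval_ne_zero_of_eval (h : IsMonomialC4 c σ x₁ x₂ x₃ x₄) (p : MvPolynomial (Fin 3) k)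
    (v : Fin 3 → k) (hp : eval v p ≠ 0) : aeval ![x₁, x₂, x₃] p ≠ 0 :=
  h.aeval_ne_zero fun h0 => hp (by simp [h0])

theorem x₁_ne_zero (h : IsMonomialC4 c σ x₁ x₂ x₃ x₄) : x₁ ≠ 0 := by
  simpa using h.aeval_ne_zero_of_eval (X 0) (fun _ => 1) (by simp)

theorem x₂_ne_zero (h : IsMonomialC4 c σ x₁ x₂ x₃ x₄) : x₂ ≠ 0 := by
  simpa using h.aeval_ne_zero_of_eval (X 1) (fun _ => 1) (by simp)

theorem x₃_ne_zero (h : IsMonomialC4 c σ x₁ x₂ x₃ x₄) : x₃ ≠ 0 := by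
  simpa using h.aeval_ne_zero_of_eval (X 2) (fun _ => 1) (by simp)

theorem x₄_ne_zero (h : IsMonomialC4 c σ x₁ x₂ x₃ x₄) : x₄ ≠ 0 := by
  rw [← h.map₃]; simpa using h.x₃_ne_zero

theorem eq_top_of_mem (h : IsMonomialC4 c σ x₁ x₂ x₃ x₄) {K : IntermediateField k M}
    (h₁ : x₁ ∈ K) (h₂ : x₂ ∈ K) (h₃ : x₃ ∈ K) : K = ⊤ := by
  rw [eq_top_iff, ← h.gen, IntermediateField.adjoin_le_iff]
  rintro _ ⟨i, rfl⟩
  fin_cases i <;> assumption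

theorem algHom_ext {E : Type*} [Field E] [Algebra k E]
    (h : IsMonomialC4 c σ x₁ x₂ x₃ x₄) {τ τ' : M →ₐ[k] E}
    (h₁ : τ x₁ = τ' x₁) (h₂ : τ x₂ = τ' x₂) (h₃ : τ x₃ = τ' x₃) : τ = τ' := by
  ext x
  have : x ∈ IntermediateField.adjoin k (Set.range ![x₁, x₂, x₃]) := by rw [h.gen]; trivial
  induction this using IntermediateField.adjoin_induction with
  | mem x hx => obtain ⟨i, rfl⟩ := hx; fin_cases i <;> assumption
  | algebraMap x => simp
  | add x y _ _ hx hy => simp [hx, hy]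
  | mul x y _ _ hx hy => simp [hx, hy]
  | inv x _ hx => simp [hx]

theorem pow_four (h : IsMonomialC4 c σ x₁ x₂ x₃ x₄) : σ ^ 4 = 1 := by
  have : ((σ ^ 4 : M ≃ₐ[k] M) : M →ₐ[k] M) = AlgHom.id k M := by
    apply h.algHom_ext <;> simp [pow_succ, h.map₁, h.map₂, h.map₃, h.map₄]
  ext x
  exact DFunLike.congr_fun this x

theorem apply_four (h : IsMonomialC4 c σ x₁ x₂ x₃ x₄) (x : M) : σ (σ (σ (σ x))) = x := by
  have := DFunLike.congr_fun h.pow_four x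
  simpa [pow_succ] using this

theorem orderOf_eq (h : IsMonomialC4 c σ x₁ x₂ x₃ x₄) : orderOf σ = 4 := by
  have : orderOf σ = 2 ^ (1 + 1) := by
    apply orderOf_eq_prime_pow
    · intro h2
      have h3 := DFunLike.congr_fun h2 x₁
      simp [pow_succ, h.map₁, h.map₂] at h3
      have := h.aeval_ne_zero (p := X 2 - X 0) (by
        rw [sub_ne_zero]; intro h; simpa using X_injective h)
      simp [h3] at this
    · exact h.pow_four
  simpa using this

theorem mem_fixedField (x : M) :
    x ∈ IntermediateField.fixedField (Subgroup.zpowers σ) ↔ σ x = x := by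
  rw [IntermediateField.mem_fixedField_iff]
  refine ⟨fun h => h σ (Subgroup.mem_zpowers σ), fun h f hf => ?_⟩
  have : Subgroup.zpowers σ ≤ MulAction.stabilizer (M ≃ₐ[k] M) x := by
    rw [Subgroup.zpowers_le]; exact h
  exact this hf

theorem finrank_fixedField (h : IsMonomialC4 c σ x₁ x₂ x₃ x₄) :
    Module.finrank (IntermediateField.fixedField (Subgroup.zpowers σ)) M = 4 := by
  have hf : Finite (Subgroup.zpowers σ) := by
    apply Nat.finite_of_card_ne_zero
    rw [Nat.card_zpowers, h.orderOf_eq]; norm_num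
  have := Fintype.ofFinite (Subgroup.zpowers σ)
  have h1 := FixedPoints.finrank_eq_card (Subgroup.zpowers σ) M
  rw [← Nat.card_eq_fintype_card, Nat.card_zpowers, h.orderOf_eq] at h1
  exact h1

theorem finite_fixedField (h : IsMonomialC4 c σ x₁ x₂ x₃ x₄) :
    FiniteDimensional (IntermediateField.fixedField (Subgroup.zpowers σ)) M :=
  Module.finite_of_finrank_pos (by rw [h.finrank_fixedField]; norm_num)

theorem trdeg_eq (h : IsMonomialC4 c σ x₁ x₂ x₃ x₄) : Algebra.trdeg k M = 3 :=
  trdeg_eq_three_of_indep h.indep h.gen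

theorem isRational_of_finrank_le (h : IsMonomialC4 c σ x₁ x₂ x₃ x₄) {u₁ u₂ u₃ : M}
    (h₁ : σ u₁ = u₁) (h₂ : σ u₂ = u₂) (h₃ : σ u₃ = u₃)
    (hfin : FiniteDimensional (IntermediateField.adjoin k (Set.range ![u₁, u₂, u₃])) M ∧
      Module.finrank (IntermediateField.adjoin k (Set.range ![u₁, u₂, u₃])) M ≤ 4) :
    IsRational k (IntermediateField.fixedField (Subgroup.zpowers σ)) := by
  have hfd := hfin.1
  have hle : IntermediateField.adjoin k (Set.range ![u₁, u₂, u₃]) ≤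
      IntermediateField.fixedField (Subgroup.zpowers σ) := by
    rw [IntermediateField.adjoin_le_iff]
    rintro _ ⟨i, rfl⟩
    rw [SetLike.mem_coe, mem_fixedField]
    fin_cases i <;> assumption
  have heq := IntermediateField.eq_of_le_of_finrank_le' hle
    (by rw [h.finrank_fixedField]; exact hfin.2)
  have hu : AlgebraicIndependent k ![u₁, u₂, u₃] :=
    algebraicIndependent_of_isAlgebraic_adjoin h.trdeg_eq
  exact ⟨3, ⟨(hu.aevalEquivField.trans (IntermediateField.equivOfEq heq)).symm⟩⟩

theorem ne_zero_of_ringChar (h : IsMonomialC4 c σ x₁ x₂ x₃ x₄) (h2 : ringChar k ≠ 2) :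
    (2 : M) ≠ 0 := by
  have := (map_ne_zero (algebraMap k M)).2 (Ring.two_ne_zero h2)
  rwa [map_ofNat] at this

end IsMonomialC4

namespace IsMonomialC4

variable {k M : Type*} [Field k] [Field M] [Algebra k M] {c : k} {σ : M ≃ₐ[k] M}
  {x₁ x₂ x₃ x₄ : M}

theorem x₄_eq (h : IsMonomialC4 c σ x₁ x₂ x₃ x₄) : x₄ = algebraMap k M c / (x₁ * x₂ * x₃) := by
  have h1 := h.x₁_ne_zero
  have h2 := h.x₂_ne_zero
  have h3 := h.x₃_ne_zero
  rw [← h.prod]; field_simp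

theorem ne_zero_of_eval (h : IsMonomialC4 c σ x₁ x₂ x₃ x₄) (p : MvPolynomial (Fin 3) k)
    (v : Fin 3 → k) (hp : eval v p ≠ 0) {y : M} (hy : y = 0 → aeval ![x₁, x₂, x₃] p = 0) :
    y ≠ 0 :=
  fun h0 => h.aeval_ne_zero_of_eval p v hp (hy h0)

theorem isRational_of_ringChar (h : IsMonomialC4 c σ x₁ x₂ x₃ x₄) (hc : c ≠ 0)
    (hk : ringChar k = 2) :
    IsRational k (IntermediateField.fixedField (Subgroup.zpowers σ)) := by
  have h2 : (2 : M) = 0 := by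
    have h2k : (2 : k) = 0 := by
      have := ringChar.spec k 2
      rw [hk] at this
      exact_mod_cast this.2 dvd_rfl
    have := congrArg (algebraMap k M) h2k
    rwa [map_ofNat, map_zero] at this
  have n1 := h.x₁_ne_zero
  have n2 := h.x₂_ne_zero
  have n3 := h.x₃_ne_zero
  have e1 := h.map₁
  have e2 := h.map₂
  have e3 := h.map₃
  have e4 := h.map₄
  have h4 := h.x₄_eq
  have hprod := h.prod
  set c' := algebraMap k M c with hc'
  have hA : x₁ + x₃ ≠ 0 :=
    h.ne_zero_of_eval (X 0 + X 2) ![1, 0, 0] (by simp) fun h0 => by simpa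
  have hA' : x₂ + x₄ ≠ 0 := by
    refine h.ne_zero_of_eval (X 0 * X 1 ^ 2 * X 2 + C c) 0 (by simpa) fun this => ?_
    rw [h4] at this
    field_simp at this
    simp
    linear_combination this
  have hq : x₁ * x₄ + x₂ * x₃ ≠ 0 := by
    refine h.ne_zero_of_eval (X 1 ^ 2 * X 2 ^ 2 + C c) 0 (by simpa) fun this => ?_
    rw [h4] at this
    field_simp at this
    simp
    linear_combination this
  have hq' : x₁ * x₂ + x₃ * x₄ ≠ 0 := by
    have := (map_ne_zero σ).2 hq
    simp only [map_add, map_mul, e1, e2, e3, e4] at this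
    rwa [mul_comm x₂ x₁] at this
  have hW : (x₁ + x₃) * (x₁ * x₄ + x₂ * x₃) + (x₂ + x₄) * (x₁ * x₂ + x₃ * x₄) ≠ 0 := by
    refine h.ne_zero_of_eval ((X 0 + X 2) * X 0 ^ 2 * X 1 * (C c + X 1 ^ 2 * X 2 ^ 2) +
      (X 0 * X 1 ^ 2 * X 2 + C c) * (C c + X 0 ^ 2 * X 1 ^ 2)) 0 (by simpa) fun this => ?_
    rw [h4] at this
    field_simp at this
    simp
    linear_combination this
  have hcW : c' * ((x₁ + x₃) * (x₁ * x₄ + x₂ * x₃) + (x₂ + x₄) * (x₁ * x₂ + x₃ * x₄)) ^ 4 -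
      ((x₁ * x₄ + x₂ * x₃) * (x₁ * x₂ + x₃ * x₄)) ^ 4 ≠ 0 := by
    refine h.ne_zero_of_eval (C c * ((X 0 + X 2) * X 0 ^ 2 * X 1 * (C c + X 1 ^ 2 * X 2 ^ 2) +
      (X 0 * X 1 ^ 2 * X 2 + C c) * (C c + X 0 ^ 2 * X 1 ^ 2)) ^ 4 -
      (X 0 * (C c + X 1 ^ 2 * X 2 ^ 2) * (C c + X 0 ^ 2 * X 1 ^ 2)) ^ 4) 0 (by simpa)
      fun this => ?_
    have e5 : (x₁ + x₃) * (x₁ * x₄ + x₂ * x₃) + (x₂ + x₄) * (x₁ * x₂ + x₃ * x₄) =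
        ((x₁ + x₃) * x₁ ^ 2 * x₂ * (c' + x₂ ^ 2 * x₃ ^ 2) +
      (x₁ * x₂ ^ 2 * x₃ + c') * (c' + x₁ ^ 2 * x₂ ^ 2)) / (x₁ ^ 2 * x₂ ^ 2 * x₃) := by
      rw [h4]; field_simp; ring
    have e6 : (x₁ * x₄ + x₂ * x₃) * (x₁ * x₂ + x₃ * x₄) =
       x₁ * (c' + x₂ ^ 2 * x₃ ^ 2) * (c' + x₁ ^ 2 * x₂ ^ 2) / (x₁ ^ 2 * x₂ ^ 2 * x₃) := by
      rw [h4]; field_simp; ring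
    rw [e5, e6, div_pow, div_pow, mul_div, div_sub_div_same, div_eq_zero_iff] at this
    simp
    refine this.resolve_right (by positivity)
  set A := x₁ + x₃ with hAdef
  set A' := x₂ + x₄ with hA'def
  set q := x₁ * x₄ + x₂ * x₃ with hqdef
  set q' := x₁ * x₂ + x₃ * x₄ with hq'def
  have sA : σ A = A' := by simp [A, A', e1, e3]
  have sA' : σ A' = A := by simp [A, A', e2, e4]; ring
  have sq : σ q = q' := by simp [q, q', e1, e2, e3, e4]; ring
  have sq' : σ q' = q := by simp [q, q', e1, e2, e3, e4]; ring
  have hqq : q + q' = A * A' := by simp only [A, A', q, q']; ring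
  obtain ⟨e, he⟩ : ∃ e, x₁ * x₃ * A' ^ 2 - x₂ * x₄ * A ^ 2 = q * q' + 2 * e := by
    refine ⟨- x₁ * x₄ * q' - x₃ * x₄ * q + 2 * x₁ * x₃ * x₄ ^ 2, ?_⟩
    simp only [A, A', q, q']
    ring
  clear_value A A' q q'
  obtain ⟨τ, hτ⟩ : ∃ z, z = x₁ * x₃ * A' ^ 2 / (q * q') := ⟨_, rfl⟩
  obtain ⟨E, hE⟩ : ∃ z, z = A / q' := ⟨_, rfl⟩
  obtain ⟨E', hE'⟩ : ∃ z, z = A' / q := ⟨_, rfl⟩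
  obtain ⟨W, hWdef⟩ : ∃ z, z = E + E' := ⟨_, rfl⟩
  have hW0 : W ≠ 0 := by
    rw [hWdef, hE, hE', div_add_div _ _ hq' hq, div_ne_zero_iff]
    exact ⟨by rwa [mul_comm q'], mul_ne_zero hq' hq⟩
  have hcW' : c' * W ^ 4 ≠ 1 := by
    intro h0
    apply hcW
    rw [hWdef, hE, hE', div_add_div _ _ hq' hq, div_pow, mul_div, div_eq_one_iff_eq (by positivity)] at h0
    linear_combination h0
  obtain ⟨s, hs⟩ : ∃ z, z = q / (A * A') := ⟨_, rfl⟩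
  obtain ⟨a, ha⟩ : ∃ z, z = q * q' / (A * A') ^ 2 := ⟨_, rfl⟩
  obtain ⟨t, ht⟩ : ∃ z, z = x₁ / A := ⟨_, rfl⟩
  obtain ⟨Y, hY⟩ : ∃ z, z = τ + s := ⟨_, rfl⟩
  obtain ⟨U, hU⟩ : ∃ z, z = E + W * s := ⟨_, rfl⟩
  obtain ⟨Q, hQ⟩ : ∃ z, z = A * A' / (q * q') := ⟨_, rfl⟩
  obtain ⟨u, hu⟩ : ∃ z, z = (U + Y * W) / (Q * W) := ⟨_, rfl⟩
  have sE : σ E = E' := by simp [hE, hE', sA, sq']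
  have sE' : σ E' = E := by simp [hE, hE', sA', sq]
  have sW : σ W = W := by rw [hWdef, map_add, sE, sE', add_comm]
  have sQ : σ Q = Q := by simp [hQ, sA, sA', sq, sq', mul_comm]
  have ss : σ s = 1 - s := by
    simp only [hs, map_div₀, map_mul, sA, sA', sq]
    field_simp
    linear_combination hqq
  have sτ : σ τ = τ - 1 := by
    simp only [hτ, map_div₀, map_mul, map_pow, sA', sq, sq', e1, e3]
    field_simp
    linear_combination -he - e * h2
  have sY : σ Y = Y := by
    simp only [hY, map_add, sτ, ss]
    linear_combination -s * h2
  have sU : σ U = U := by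
    rw [hU, map_add, map_mul, sE, sW, ss, hWdef]
    linear_combination (E' - (E + E') * s) * h2
  have su : σ u = u := by simp [hu, sU, sW, sQ, sY]
  have rs : s ^ 2 + s = a := by
    simp only [hs, ha]
    field_simp
    linear_combination -hqq + q * h2
  have rτ : τ ^ 2 + τ + c' * Q ^ 2 = 0 := by
    simp only [hτ, hQ, ← hprod]
    field_simp
    linear_combination x₁ * x₃ * A' ^ 2 * (- he + (x₁ * x₃ * A' ^ 2 - e) * h2)
  have rQ : a = c' * Q ^ 2 + Y ^ 2 + Y := by
    rw [← rs, hY]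
    linear_combination - rτ - s * τ * h2
  have rt : t ^ 2 + t = a * (Y + s) := by
    have : t ^ 2 + t = a * τ := by
      simp only [ht, ha, hτ]
      field_simp
      linear_combination hAdef + x₁ * h2
    rw [this, hY]
    linear_combination - a * s * h2
  have hQE : Q = E * E' := by simp only [hQ, hE, hE']; field_simp
  have rU : Q = (U + Y * W) ^ 2 + (U + Y * W) * W + c' * Q ^ 2 * W ^ 2 := by
    simp only [hU, hY]
    linear_combination -W ^ 2 * rτ - E * hWdef + hQE -
      (E ^ 2 + E * W * (2 * s + τ) + W ^ 2 * (2 * s ^ 2 + 2 * s * τ + s)) * h2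
  have hQ0 : Q ≠ 0 := by simp only [hQ]; positivity
  have hs0 : s ≠ 0 := by simp only [hs]; positivity
  have hs1 : s + 1 ≠ 0 := by
    intro h0
    have : σ s = 0 := by rw [ss]; linear_combination h2 - h0
    exact (map_ne_zero σ).2 hs0 this
  have rU' : U + Y * W = u * (Q * W) := by simp only [hu]; field_simp
  have hu1 : Q * W * (W * (u ^ 2 + c')) = 1 - u * W ^ 2 := by
    rw [rU'] at rU
    apply mul_left_cancel₀ hQ0
    linear_combination - rU
  have huc : u ^ 2 + c' ≠ 0 := by
    intro h0
    rw [h0] at hu1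
    apply hcW'
    linear_combination W ^ 4 * h0 - (1 + u * W ^ 2) * hu1 - h2
  have rZ : Q = (1 - u * W ^ 2) / (W * (u ^ 2 + c')) / W := by
    rw [← hu1]; field_simp
  have rA : A = (U + W * s) / (s * Q) := by
    have h5 : U + W * s = E := by rw [hU]; linear_combination W * s * h2
    rw [h5, hE, hs, hQ]; field_simp
  have rA' : A' = (U + W * (s + 1)) / ((s + 1) * Q) := by
    have h5 : U + W * (s + 1) = E' := by
      rw [hU, hWdef]; linear_combination ((E + E') * s + E) * h2
    have h6 : s + 1 = q' / (A * A') := by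
      have : q' / (A * A') = 1 - s := by rw [hs]; field_simp; linear_combination hqq
      rw [this]; linear_combination s * h2
    rw [h5, h6, hE', hQ]; field_simp
  have r₁ : x₁ = A * t := by simp only [ht]; field_simp
  have r₂ : x₂ = A' * (t + s) := by
    rw [ht, hs]; field_simp
    rw [hAdef, hA'def, hqdef]
    linear_combination - x₁ * x₄ * h2
  have r₃ : x₃ = A - x₁ := by rw [hAdef]; ring
  have hL : ∀ K : IntermediateField k M, IntermediateField.adjoin k (Set.range ![Y, W, u]) ≤ K →
      Y ∈ K ∧ W ∈ K ∧ u ∈ K ∧ c' ∈ K := by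
    intro K hK
    have := fun i => hK (IntermediateField.subset_adjoin k _ ⟨i, rfl⟩)
    exact ⟨this 0, this 1, this 2, K.algebraMap_mem c⟩
  refine h.isRational_of_finrank_le sY sW su (finrank_le_four_of_quadratic_tower _ (s := s) (t := t)
    (a := -1) (b := c' * Q ^ 2 + Y ^ 2 + Y) (a' := -1) (b' := (c' * Q ^ 2 + Y ^ 2 + Y) * (Y + s))
    (neg_mem (one_mem _)) ?_ ?_ (fun K _ _ => neg_mem (one_mem _)) ?_ ?_ ?_)
  · obtain ⟨m1, m2, m3, m4⟩ := hL _ le_rfl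
    rw [rZ]
    repeat' first | assumption | exact one_mem _ | apply add_mem | apply sub_mem | apply mul_mem |
      apply div_mem | apply pow_mem
  · rw [← rQ, ← rs]; ring
  · intro K hK hs
    obtain ⟨m1, m2, m3, m4⟩ := hL _ hK
    rw [rZ]
    repeat' first | assumption | exact one_mem _ | apply add_mem | apply sub_mem | apply mul_mem |
      apply div_mem | apply pow_mem
  · rw [← rQ, ← rt]; ring
  · intro K hK hs ht
    obtain ⟨m1, m2, m3, m4⟩ := hL _ hK
    have mQ : Q ∈ K := by
      rw [rZ]
      repeat' first | assumption | exact one_mem _ | apply add_mem | apply sub_mem | apply mul_mem |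
        apply div_mem | apply pow_mem
    have mU : U ∈ K := by
      rw [eq_sub_of_add_eq rU']
      repeat' first | assumption | exact one_mem _ | apply add_mem | apply sub_mem | apply mul_mem
    have mA : A ∈ K := by
      rw [rA]
      repeat' first | assumption | exact one_mem _ | apply add_mem | apply sub_mem | apply mul_mem |
        apply div_mem
    have mA' : A' ∈ K := by
      rw [rA']
      repeat' first | assumption | exact one_mem _ | apply add_mem | apply sub_mem | apply mul_mem |
        apply div_mem
    have m₁ : x₁ ∈ K := by rw [r₁]; exact mul_mem mA ht
    exact h.eq_top_of_mem m₁ (by rw [r₂]; exact mul_mem mA' (add_mem ht hs))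
      (by rw [r₃]; exact sub_mem mA m₁)

end IsMonomialC4

namespace IsMonomialC4

variable {k M : Type*} [Field k] [Field M] [Algebra k M] {c : k} {σ : M ≃ₐ[k] M}
  {x₁ x₂ x₃ x₄ : M}

theorem isRational_of_sq_eq (h : IsMonomialC4 c σ x₁ x₂ x₃ x₄) (hc : c ≠ 0)
    (hk : ringChar k ≠ 2) {d₀ : k} (hd₀ : d₀ ^ 2 = c) :
    IsRational k (IntermediateField.fixedField (Subgroup.zpowers σ)) := by
  have h2 : (2 : M) ≠ 0 := h.ne_zero_of_ringChar hk
  have h2k : (2 : k) ≠ 0 := Ring.two_ne_zero hk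
  have hd0' : d₀ ≠ 0 := by rintro rfl; exact hc (by rw [← hd₀]; ring)
  have n1 := h.x₁_ne_zero
  have n2 := h.x₂_ne_zero
  have n3 := h.x₃_ne_zero
  have e1 := h.map₁
  have e2 := h.map₂
  have e3 := h.map₃
  have e4 := h.map₄
  obtain ⟨d, hd⟩ : ∃ z, z = algebraMap k M d₀ := ⟨_, rfl⟩
  have sd : σ d = d := by rw [hd]; simp
  have hd0 : d ≠ 0 := by rw [hd]; simpa
  have h4 : x₄ = d ^ 2 / (x₁ * x₂ * x₃) := by rw [h.x₄_eq, ← hd₀, hd, map_pow]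
  have k1 : d + x₁ * x₂ ≠ 0 :=
    h.ne_zero_of_eval (C d₀ + X 0 * X 1) 0 (by simpa) fun h0 => by simpa [← hd]
  have k2 : d + x₂ * x₃ ≠ 0 :=
    h.ne_zero_of_eval (C d₀ + X 1 * X 2) 0 (by simpa) fun h0 => by simpa [← hd]
  have k3 : d - x₁ * x₂ ≠ 0 :=
    h.ne_zero_of_eval (C d₀ - X 0 * X 1) 0 (by simpa) fun h0 => by simpa [← hd]
  have k4 : d - x₂ * x₃ ≠ 0 :=
    h.ne_zero_of_eval (C d₀ - X 1 * X 2) 0 (by simpa) fun h0 => by simpa [← hd]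
  have k5 : x₁ ^ 2 * (d + x₂ * x₃) ^ 2 - d * (d + x₁ * x₂) ^ 2 ≠ 0 :=
    h.ne_zero_of_eval (X 0 ^ 2 * (C d₀ + X 1 * X 2) ^ 2 - C d₀ * (C d₀ + X 0 * X 1) ^ 2) 0
      (by simpa) fun h0 => by simpa [← hd]
  have k6 : x₁ ^ 2 * (d - x₂ * x₃) ^ 2 + d * (d - x₁ * x₂) ^ 2 ≠ 0 :=
    h.ne_zero_of_eval (X 0 ^ 2 * (C d₀ - X 1 * X 2) ^ 2 + C d₀ * (C d₀ - X 0 * X 1) ^ 2) 0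
      (by simpa) fun h0 => by simpa [← hd]
  have k7 : (d - x₂ * x₃) ^ 2 * (d + x₁ * x₂) ^ 2 + (d + x₂ * x₃) ^ 2 * (d - x₁ * x₂) ^ 2 ≠ 0 :=
    h.ne_zero_of_eval ((C d₀ - X 1 * X 2) ^ 2 * (C d₀ + X 0 * X 1) ^ 2 +
      (C d₀ + X 1 * X 2) ^ 2 * (C d₀ - X 0 * X 1) ^ 2) 0
      (by simpa [← two_mul, h2k]) fun h0 => by simpa [← hd]
  obtain ⟨p, hp⟩ : ∃ z, z = x₁ * x₂ := ⟨_, rfl⟩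
  obtain ⟨q, hq⟩ : ∃ z, z = x₂ * x₃ := ⟨_, rfl⟩
  rw [← hp] at k1 k3 k5 k6 k7
  rw [← hq] at k2 k4 k5 k6 k7
  have hp0 : p ≠ 0 := by rw [hp]; positivity
  have hq0 : q ≠ 0 := by rw [hq]; positivity
  have sp : σ p = q := by rw [hp, hq, map_mul, e1, e2]
  have sq : σ q = d ^ 2 / p := by rw [hp, hq, map_mul, e2, e3, h4]; field_simp
  obtain ⟨r, hr⟩ : ∃ z, z = x₁ * (d + q) / (d + p) := ⟨_, rfl⟩
  obtain ⟨g, hg⟩ : ∃ z, z = (d - p) / (d + p) := ⟨_, rfl⟩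
  obtain ⟨g', hg'⟩ : ∃ z, z = (d - q) / (d + q) := ⟨_, rfl⟩
  obtain ⟨y, hy⟩ : ∃ z, z = g' / g := ⟨_, rfl⟩
  have hr0 : r ≠ 0 := by rw [hr]; positivity
  have hg0 : g ≠ 0 := by rw [hg]; positivity
  have hg'0 : g' ≠ 0 := by rw [hg']; positivity
  have hy0 : y ≠ 0 := by rw [hy]; positivity
  have sr : σ r = d / r := by
    rw [hr]
    simp only [map_div₀, map_mul, map_add, sd, e1, sp, sq]
    have : x₂ = p / x₁ := by rw [hp]; field_simp
    rw [this]
    field_simp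
    ring
  have sg : σ g = g' := by rw [hg, hg']; simp [sp, sd]
  have sg' : σ g' = -g := by
    rw [hg', hg]
    simp only [map_div₀, map_add, map_sub, sd, sq]
    have : d + d ^ 2 / p ≠ 0 := by
      have : d + d ^ 2 / p = d * (d + p) / p := by field_simp; ring
      rw [this]; positivity
    have k1' : p + d ≠ 0 := by rwa [add_comm]
    field_simp
    ring
  have sy : σ y = -1 / y := by
    rw [hy, map_div₀, sg, sg']; field_simp
  have hrd : r ^ 2 - d ≠ 0 := by
    have : r ^ 2 - d = (x₁ ^ 2 * (d + q) ^ 2 - d * (d + p) ^ 2) /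
      (d + p) ^ 2 := by rw [hr]; field_simp
    rw [this]; positivity
  have hry : r ^ 2 * y ^ 2 + d ≠ 0 := by
    have : r ^ 2 * y ^ 2 + d = (x₁ ^ 2 * (d - q) ^ 2 + d * (d - p) ^ 2) /
      (d - p) ^ 2 := by rw [hr, hy, hg, hg']; field_simp
    rw [this]; positivity
  have hy1 : y ^ 2 + 1 ≠ 0 := by
    have : y ^ 2 + 1 = ((d - q) ^ 2 * (d + p) ^ 2 +
      (d + q) ^ 2 * (d - p) ^ 2) / ((d - p) * (d + q)) ^ 2 := by
      rw [hy, hg, hg']; field_simp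
    rw [this]; positivity
  have r₁ : x₁ = r * (1 + g') / (1 + g) := by
    have h5 : 1 + g' = 2 * d / (d + q) := by rw [hg']; field_simp; ring
    have h6 : 1 + g = 2 * d / (d + p) := by rw [hg]; field_simp; ring
    rw [h5, h6, hr]; field_simp
  have r₂ : x₂ = d * (1 - g) / (1 + g) / x₁ := by
    have : x₂ = p / x₁ := by rw [hp]; field_simp
    rw [this]
    have h5 : 1 - g = 2 * p / (d + p) := by rw [hg]; field_simp; ring
    have h6 : 1 + g = 2 * d / (d + p) := by rw [hg]; field_simp; ring
    rw [h5, h6]; field_simp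
  have r₃ : x₃ = d * (1 - g') / (1 + g') / x₂ := by
    have : x₃ = q / x₂ := by rw [hq]; field_simp
    rw [this]
    have h5 : 1 - g' = 2 * q / (d + q) := by rw [hg']; field_simp; ring
    have h6 : 1 + g' = 2 * d / (d + q) := by rw [hg']; field_simp; ring
    rw [h5, h6]; field_simp
  have ry : g' = y * g := by rw [hy]; field_simp
  obtain ⟨D, hD⟩ : ∃ z, z = r ^ 2 * y ^ 2 + d := ⟨_, rfl⟩
  rw [← hD] at hry
  obtain ⟨w, hw⟩ : ∃ z, z = g ^ 2 + g' ^ 2 := ⟨_, rfl⟩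
  obtain ⟨u, hu⟩ : ∃ z, z = (r ^ 2 - d) * y / D := ⟨_, rfl⟩
  obtain ⟨v, hv⟩ : ∃ z, z = (y ^ 2 + 1) * r / D := ⟨_, rfl⟩
  have sw : σ w = w := by rw [hw]; simp [sg, sg']; ring
  have sD : σ D = d * D / (r * y) ^ 2 := by
    rw [hD]
    simp only [map_mul, map_add, map_pow, sd, sr, sy]
    field_simp
    ring
  have su : σ u = u := by
    rw [hu]
    simp only [map_div₀, map_mul, map_sub, map_pow, sd, sr, sy, sD]
    field_simp
    ring
  have sv : σ v = v := by
    rw [hv]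
    simp only [map_div₀, map_mul, map_add, map_pow, map_one, sr, sy, sD]
    field_simp
    ring
  have hvr : v * r - 1 = (r ^ 2 - d) / D := by rw [hv]; field_simp; rw [hD]; ring
  have hvr0 : v * r - 1 ≠ 0 := by rw [hvr]; positivity
  have hv0 : v ≠ 0 := by rw [hv]; positivity
  have ryu : y = u / (v * r - 1) := by rw [hvr, hu]; field_simp
  have rr : r ^ 2 = (1 + v ^ 2 * d + u ^ 2) / v * r + -d := by
    have : v * r ^ 2 + v * d = (1 + v ^ 2 * d + u ^ 2) * r := by
      rw [hv, hu]; field_simp; rw [hD]; ring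
    field_simp
    linear_combination this
  have rg : g ^ 2 = 0 * g + w / (y ^ 2 + 1) := by
    rw [hw, ry]; field_simp; ring
  clear hr hg hg' hy hw hu hv
  have hL : ∀ K : IntermediateField k M, IntermediateField.adjoin k (Set.range ![u, v, w]) ≤ K →
      u ∈ K ∧ v ∈ K ∧ w ∈ K ∧ d ∈ K := by
    intro K hK
    have := fun i => hK (IntermediateField.subset_adjoin k _ ⟨i, rfl⟩)
    exact ⟨this 0, this 1, this 2, hd ▸ K.algebraMap_mem d₀⟩
  have hyK : ∀ K : IntermediateField k M, IntermediateField.adjoin k (Set.range ![u, v, w]) ≤ K →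
      r ∈ K → y ∈ K := by
    intro K hK hr
    obtain ⟨m1, m2, m3, m4⟩ := hL _ hK
    rw [ryu]
    exact div_mem m1 (sub_mem (mul_mem m2 hr) (one_mem _))
  refine h.isRational_of_finrank_le su sv sw (finrank_le_four_of_quadratic_tower _ ?_ ?_ rr ?_ ?_ rg
    ?_)
  · obtain ⟨m1, m2, m3, m4⟩ := hL _ le_rfl
    exact div_mem (add_mem (add_mem (one_mem _) (mul_mem (pow_mem m2 2) m4)) (pow_mem m1 2)) m2
  · exact neg_mem (hL _ le_rfl).2.2.2
  · exact fun K _ _ => zero_mem K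
  · intro K hK hr
    exact div_mem (hL _ hK).2.2.1 (add_mem (pow_mem (hyK K hK hr) 2) (one_mem K))
  · intro K hK hr hg
    obtain ⟨m1, m2, m3, m4⟩ := hL _ hK
    have mg' : g' ∈ K := by rw [ry]; exact mul_mem (hyK K hK hr) hg
    have m₁ : x₁ ∈ K := by
      rw [r₁]; exact div_mem (mul_mem hr (add_mem (one_mem K) mg')) (add_mem (one_mem K) hg)
    have m₂ : x₂ ∈ K := by
      rw [r₂]
      exact div_mem (div_mem (mul_mem m4 (sub_mem (one_mem K) hg)) (add_mem (one_mem K) hg)) m₁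
    have m₃ : x₃ ∈ K := by
      rw [r₃]
      exact div_mem (div_mem (mul_mem m4 (sub_mem (one_mem K) mg')) (add_mem (one_mem K) mg')) m₂
    exact h.eq_top_of_mem m₁ m₂ m₃

end IsMonomialC4

namespace IsMonomialC4

variable {k M : Type*} [Field k] [Field M] [Algebra k M] {c : k} {σ : M ≃ₐ[k] M}
  {x₁ x₂ x₃ x₄ : M}

theorem smul (h : IsMonomialC4 c σ x₁ x₂ x₃ x₄) {l : k} (hl : l ≠ 0) :
    IsMonomialC4 (l ^ 4 * c) σ (algebraMap k M l * x₁) (algebraMap k M l * x₂)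
      (algebraMap k M l * x₃) (algebraMap k M l * x₄) := by
  have hl' : algebraMap k M l ≠ 0 := by simpa
  have hgen : IntermediateField.adjoin k (Set.range ![algebraMap k M l * x₁,
      algebraMap k M l * x₂, algebraMap k M l * x₃]) = ⊤ := by
    have := fun i => IntermediateField.subset_adjoin k (Set.range ![algebraMap k M l * x₁,
      algebraMap k M l * x₂, algebraMap k M l * x₃]) ⟨i, rfl⟩
    have h' : ∀ x, algebraMap k M l * x ∈ IntermediateField.adjoin k (Set.range
        ![algebraMap k M l * x₁, algebraMap k M l * x₂, algebraMap k M l * x₃]) →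
        x ∈ IntermediateField.adjoin k (Set.range
        ![algebraMap k M l * x₁, algebraMap k M l * x₂, algebraMap k M l * x₃]) := by
      intro x hx
      have := div_mem hx (IntermediateField.algebraMap_mem _ l)
      rwa [mul_div_cancel_left₀ _ hl'] at this
    exact h.eq_top_of_mem (h' _ (this 0)) (h' _ (this 1)) (h' _ (this 2))
  have : Algebra.IsAlgebraic (IntermediateField.adjoin k (Set.range ![algebraMap k M l * x₁,
      algebraMap k M l * x₂, algebraMap k M l * x₃])) M := by
    rw [hgen, Algebra.isAlgebraic_iff_isIntegral]
    exact Algebra.isIntegral_of_surjective IntermediateField.topEquiv.surjective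
  refine ⟨algebraicIndependent_of_isAlgebraic_adjoin h.trdeg_eq, hgen, ?_, ?_, ?_, ?_, ?_⟩
  · simp [h.map₁]
  · simp [h.map₂]
  · simp [h.map₃]
  · simp [h.map₄]
  · rw [map_mul, map_pow, ← h.prod]; ring

theorem isRational_of_eq_neg_four (h : IsMonomialC4 (-4 : k) σ x₁ x₂ x₃ x₄)
    (hk : ringChar k ≠ 2) :
    IsRational k (IntermediateField.fixedField (Subgroup.zpowers σ)) := by
  have h2 : (2 : M) ≠ 0 := h.ne_zero_of_ringChar hk
  have h2k : (2 : k) ≠ 0 := Ring.two_ne_zero hk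
  have n1 := h.x₁_ne_zero
  have n2 := h.x₂_ne_zero
  have n3 := h.x₃_ne_zero
  have e1 := h.map₁
  have e2 := h.map₂
  have e3 := h.map₃
  have h4 : x₄ = -4 / (x₁ * x₂ * x₃) := by rw [h.x₄_eq]; simp [map_ofNat]
  obtain ⟨v, hv⟩ : ∃ z, z = x₁ * x₂ + 2 * x₁ + 2 := ⟨_, rfl⟩
  obtain ⟨v', hv'⟩ : ∃ z, z = x₂ * x₃ + 2 * x₂ + 2 := ⟨_, rfl⟩
  obtain ⟨R, hR⟩ : ∃ z, z = x₁ * v' := ⟨_, rfl⟩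
  obtain ⟨V, hV⟩ : ∃ z : MvPolynomial (Fin 3) k, z = X 0 * X 1 + 2 * X 0 + 2 := ⟨_, rfl⟩
  obtain ⟨P, hP⟩ : ∃ z : MvPolynomial (Fin 3) k, z = X 0 * (X 1 * X 2 + 2 * X 1 + 2) := ⟨_, rfl⟩
  have aV : aeval ![x₁, x₂, x₃] V = v := by rw [hV, hv]; simp
  have aP : aeval ![x₁, x₂, x₃] P = R := by rw [hP, hR, hv']; simp
  have eV : eval ![0, 0, 0] V = 2 := by rw [hV]; simp
  have eP : eval ![0, 0, 0] P = 0 := by rw [hP]; simp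
  have k0 : v ≠ 0 := h.ne_zero_of_eval V ![0, 0, 0] (by simpa [eV]) fun h0 => by rwa [aV]
  have k1 : R ≠ 0 := h.ne_zero_of_eval P ![1, 0, 0] (by simpa [hP]) fun h0 => by rwa [aP]
  have k2 : R - v ≠ 0 := h.ne_zero_of_eval (P - V) ![0, 0, 0] (by simp [eP, eV, h2k])
    fun h0 => by simpa [aP, aV]
  have k3 : R - 2 * v ≠ 0 := h.ne_zero_of_eval (P - 2 * V) ![0, 0, 0] (by simp [eP, eV, h2k])
    fun h0 => by simpa [aP, aV]
  have k4 : R ^ 2 - 2 * R * v + 2 * v ^ 2 ≠ 0 :=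
    h.ne_zero_of_eval (P ^ 2 - 2 * P * V + 2 * V ^ 2) ![0, 0, 0] (by simp [eP, eV, h2k])
      fun h0 => by simpa [aP, aV]
  have k5 : R ^ 2 * (R - v) * (R - 2 * v) + R * (R - 2 * v) ^ 2 * v -
      2 * (R - v) ^ 2 * (R - 2 * v) * v + 2 * R * (R - v) * v ^ 2 ≠ 0 :=
    h.ne_zero_of_eval (P ^ 2 * (P - V) * (P - 2 * V) + P * (P - 2 * V) ^ 2 * V -
      2 * (P - V) ^ 2 * (P - 2 * V) * V + 2 * P * (P - V) * V ^ 2) ![0, 0, 0] (by simp [eP, eV, h2k])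
      fun h0 => by simpa [aP, aV]
  have k6 : v' ≠ 0 := fun h0 => k1 (by rw [hR, h0, mul_zero])
  obtain ⟨r, hr⟩ : ∃ z, z = R / v := ⟨_, rfl⟩
  have hr0 : r ≠ 0 := by rw [hr]; positivity
  have hr1 : r - 1 ≠ 0 := by
    have : r - 1 = (R - v) / v := by rw [hr]; field_simp
    rw [this]; positivity
  have hr2 : r - 2 ≠ 0 := by
    have : r - 2 = (R - 2 * v) / v := by rw [hr]; field_simp
    rw [this]; positivity
  have hr3 : r ^ 2 - 2 * r + 2 ≠ 0 := by
    have : r ^ 2 - 2 * r + 2 = (R ^ 2 - 2 * R * v + 2 * v ^ 2) / v ^ 2 := by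
      rw [hr]; field_simp
    rw [this]; exact div_ne_zero k4 (pow_ne_zero 2 k0)
  have hr4 : r ^ 2 * (r - 1) * (r - 2) + r * (r - 2) ^ 2 - 2 * (r - 1) ^ 2 * (r - 2) +
      2 * r * (r - 1) ≠ 0 := by
    have : r ^ 2 * (r - 1) * (r - 2) + r * (r - 2) ^ 2 - 2 * (r - 1) ^ 2 * (r - 2) +
      2 * r * (r - 1) = (R ^ 2 * (R - v) * (R - 2 * v) + R * (R - 2 * v) ^ 2 * v -
      2 * (R - v) ^ 2 * (R - 2 * v) * v + 2 * R * (R - v) * v ^ 2) / v ^ 4 := by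
      rw [hr]; field_simp
    rw [this]; exact div_ne_zero k5 (pow_ne_zero 4 k0)
  have sv : σ v = v' := by rw [hv, hv']; simp [e1, e2, map_ofNat]
  have sv' : x₁ * x₂ * σ v' = -4 + 2 * x₁ * x₂ * x₃ + 2 * x₁ * x₂ := by
    rw [hv']; simp only [map_add, map_mul, map_ofNat, e2, e3, h4]; field_simp
  obtain ⟨y, hy⟩ : ∃ z, z = 1 / v := ⟨_, rfl⟩
  have sr : σ r = 2 * (r - 1) / r := by
    have h5 : σ r = x₁ * x₂ * σ v' / R := by
      rw [hr, hR, map_div₀, map_mul, sv, e1]; field_simp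
    have h6 : -4 + 2 * x₁ * x₂ * x₃ + 2 * x₁ * x₂ = 2 * (R - v) := by
      rw [hR, hv, hv']; ring
    rw [h5, sv', h6, hr]; field_simp
  have hy0 : y ≠ 0 := by rw [hy]; exact one_div_ne_zero k0
  have x₁_eq : x₁ = r * σ y / y := by rw [hr, hy, hR, map_div₀, map_one, sv]; field_simp
  have x₂_eq : x₂ = σ r * σ (σ y) / σ y := by rw [← e1, x₁_eq]; simp
  have x₃_eq : x₃ = σ (σ r) * σ (σ (σ y)) / σ (σ y) := by rw [← e2, x₂_eq]; simp
  have hy1 : σ y ≠ 0 := by simpa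
  have ry : 2 * (r - 1) * σ (σ y) + 2 * r * σ y + 2 * y = 1 := by
    have h5 : x₁ * x₂ = 2 * (r - 1) * σ (σ y) / y := by
      rw [x₁_eq, x₂_eq, sr]; field_simp
    have h6 : v * y = 1 := by rw [hy]; field_simp
    rw [hv, h5, x₁_eq] at h6
    field_simp at h6
    linear_combination h6
  have srr : σ (σ r) = (r - 2) / (r - 1) := by
    simp only [sr, map_div₀, map_mul, map_sub, map_one, map_ofNat]
    field_simp
    ring
  have srrr : σ (σ (σ r)) = -2 / (r - 2) := by
    have h5 : 2 * (r - 1) / r - 1 = (r - 2) / r := by field_simp; ring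
    rw [srr, map_div₀, map_sub, map_sub, map_one, map_ofNat, sr, h5]
    field_simp
    ring
  have srrrr : σ (-2 / (r - 2)) = r := by
    rw [← srrr, h.apply_four]
  obtain ⟨ω, hω⟩ : ∃ z, z = r - 2 * (r - 1) / r + (r - 2) / (r - 1) - (-2 / (r - 2)) := ⟨_, rfl⟩
  obtain ⟨β, hβ⟩ : ∃ z, z = r + 2 * (r - 1) / r + (r - 2) / (r - 1) + (-2 / (r - 2)) := ⟨_, rfl⟩
  have sβ : σ β = β := by
    rw [hβ, map_add, map_add, map_add, srrrr, ← sr, ← srr, ← srrr]; ring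
  have sω : σ ω = -ω := by
    rw [hω, map_sub, map_add, map_sub, srrrr, ← sr, ← srr, ← srrr]; ring
  have hω0 : ω ≠ 0 := by
    have : ω = (r ^ 2 * (r - 1) * (r - 2) + r * (r - 2) ^ 2 - 2 * (r - 1) ^ 2 * (r - 2) +
      2 * r * (r - 1)) / (r * (r - 1) * (r - 2)) := by rw [hω]; field_simp; ring
    rw [this]; exact div_ne_zero hr4 (by positivity)
  have hrr : σ r - r ≠ 0 := by
    have : σ r - r = -(r ^ 2 - 2 * r + 2) / r := by rw [sr]; field_simp; ring
    rw [this]; exact div_ne_zero (neg_ne_zero.2 hr3) hr0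
  have hrr' : σ (σ r) - σ r = (σ r - r) / (r - 1) := by
    rw [srr, sr]; field_simp; ring
  obtain ⟨g, hg⟩ : ∃ z, z = (y - (2 - r) / 8) / ω := ⟨_, rfl⟩
  have h8 : (8 : M) ≠ 0 := by
    have := pow_ne_zero 3 h2
    norm_num at this
    exact this
  have hgg : σ (σ g) - σ g = (σ g - g) / (r - 1) := by
    have h5 : σ g = -(σ y - (2 - σ r) / 8) / ω := by
      rw [hg]; simp only [map_div₀, map_sub, map_ofNat, sω]; field_simp
    have h6 : σ (σ g) = (σ (σ y) - (2 - σ (σ r)) / 8) / ω := by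
      rw [h5]; simp only [map_div₀, map_sub, map_ofNat, map_neg, sω]; field_simp
    rw [h6, h5, hg, srr, sr]
    field_simp
    linear_combination 4 * r * ry
  obtain ⟨f₂, hf₂⟩ : ∃ z, z = (σ g - g) / (σ r - r) := ⟨_, rfl⟩
  obtain ⟨f₁, hf₁⟩ : ∃ z, z = g - f₂ * r := ⟨_, rfl⟩
  have sf₂ : σ f₂ = f₂ := by
    rw [hf₂, map_div₀, map_sub, map_sub, hgg, hrr']
    field_simp
  have sf₁ : σ f₁ = f₁ := by
    rw [hf₁, map_sub, map_mul, sf₂, hf₂]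
    field_simp
    ring
  have y_eq : y = (2 - r) / 8 + (f₁ + f₂ * r) * ω := by
    rw [hf₁, hg]; field_simp; ring
  have hL : ∀ K : IntermediateField k M, IntermediateField.adjoin k (Set.range ![β, f₁, f₂]) ≤ K →
      β ∈ K ∧ f₁ ∈ K ∧ f₂ ∈ K := by
    intro K hK
    have := fun i => hK (IntermediateField.subset_adjoin k _ ⟨i, rfl⟩)
    exact ⟨this 0, this 1, this 2⟩
  obtain ⟨b, hb⟩ : ∃ z : IntermediateField.adjoin k (Set.range ![β, f₁, f₂]), (z : M) = β :=
    ⟨⟨β, (hL _ le_rfl).1⟩, rfl⟩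
  refine h.isRational_of_finrank_le sβ sf₁ sf₂ (finrank_le_of_root (r := r) (p :=
    Polynomial.X ^ 2 * (Polynomial.X - 1) * (Polynomial.X - 2) +
      2 * (Polynomial.X - 1) ^ 2 * (Polynomial.X - 2) + Polynomial.X * (Polynomial.X - 2) ^ 2
      - 2 * Polynomial.X * (Polynomial.X - 1)
      - Polynomial.C b * (Polynomial.X * (Polynomial.X - 1) * (Polynomial.X - 2)))
    ?_ ?_ ?_ (IntermediateField.adjoin_singleton_eq_top_of_forall _ ?_))
  · intro h0
    have := congrArg (Polynomial.eval 0) h0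
    simp at this
    have h5 := congrArg (algebraMap _ M) this
    rw [map_ofNat, map_zero] at h5
    exact h2 h5
  · have h5 : β * (r * (r - 1) * (r - 2)) = r ^ 2 * (r - 1) * (r - 2) +
        2 * (r - 1) ^ 2 * (r - 2) + r * (r - 2) ^ 2 - 2 * r * (r - 1) := by
      rw [hβ]; field_simp; ring
    simp only [map_add, map_sub, map_mul, map_pow, map_one, map_ofNat, Polynomial.aeval_X,
      Polynomial.aeval_C, IntermediateField.algebraMap_apply, hb]
    linear_combination -h5
  · compute_degree
  · intro K hK mr
    obtain ⟨m1, m2, m3⟩ := hL _ hK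
    have m0 : (2 : M) ∈ K := ofNat_mem K 2
    have m8 : (8 : M) ∈ K := ofNat_mem K 8
    have mr1 : σ r ∈ K := by
      rw [sr]
      exact div_mem (mul_mem m0 (sub_mem mr (one_mem _))) mr
    have mr2 : σ (σ r) ∈ K := by
      rw [srr]
      exact div_mem (sub_mem mr m0) (sub_mem mr (one_mem _))
    have mr3 : σ (σ (σ r)) ∈ K := by
      rw [srrr]
      exact div_mem (neg_mem m0) (sub_mem mr m0)
    have mω : ω ∈ K := by
      rw [hω, ← sr, ← srr, ← srrr]
      exact sub_mem (add_mem (sub_mem mr mr1) mr2) mr3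
    have key : ∀ z w, z ∈ K → w ∈ K → (2 - z) / 8 + (f₁ + f₂ * z) * w ∈ K := fun z w hz hw =>
      add_mem (div_mem (sub_mem m0 hz) m8) (mul_mem (add_mem m2 (mul_mem m3 hz)) hw)
    have hy1 : σ y = (2 - σ r) / 8 + (f₁ + f₂ * σ r) * -ω := by
      conv_lhs => rw [y_eq]
      simp only [map_add, map_div₀, map_sub, map_mul, map_ofNat, sω, sf₁, sf₂]
    have hy2 : σ (σ y) = (2 - σ (σ r)) / 8 + (f₁ + f₂ * σ (σ r)) * ω := by
      rw [hy1]
      simp only [map_add, map_div₀, map_sub, map_mul, map_ofNat, map_neg, sω, sf₁, sf₂, neg_neg]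
    have hy3 : σ (σ (σ y)) = (2 - σ (σ (σ r))) / 8 + (f₁ + f₂ * σ (σ (σ r))) * -ω := by
      rw [hy2]
      simp only [map_add, map_div₀, map_sub, map_mul, map_ofNat, sω, sf₁, sf₂]
    have my : y ∈ K := by rw [y_eq]; exact key _ _ mr mω
    have my1 : σ y ∈ K := by rw [hy1]; exact key _ _ mr1 (neg_mem mω)
    have my2 : σ (σ y) ∈ K := by rw [hy2]; exact key _ _ mr2 mω
    have my3 : σ (σ (σ y)) ∈ K := by rw [hy3]; exact key _ _ mr3 (neg_mem mω)
    refine h.eq_top_of_mem ?_ ?_ ?_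
    · rw [x₁_eq]; exact div_mem (mul_mem mr my1) my
    · rw [x₂_eq]; exact div_mem (mul_mem mr1 my2) my1
    · rw [x₃_eq]; exact div_mem (mul_mem mr2 my3) my2

theorem isRational_of_pow_four_eq (h : IsMonomialC4 c σ x₁ x₂ x₃ x₄) (hc : c ≠ 0)
    (hk : ringChar k ≠ 2) {d : k} (hd : d ^ 4 = -4 * c) :
    IsRational k (IntermediateField.fixedField (Subgroup.zpowers σ)) := by
  have h2k : (2 : k) ≠ 0 := Ring.two_ne_zero hk
  have hd0 : d ≠ 0 := by
    rintro rfl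
    apply hc
    have : (2 : k) ^ 2 * c = 0 := by linear_combination hd
    simpa [h2k] using this
  have h' := h.smul (l := 2 / d) (by positivity)
  have : (2 / d) ^ 4 * c = -4 := by
    have hc4 : -4 * c ≠ 0 := by rw [← hd]; positivity
    rw [div_pow, hd, div_mul_eq_mul_div, div_eq_iff hc4]; ring
  rw [this] at h'
  exact h'.isRational_of_eq_neg_four hk

end IsMonomialC4

section Eigenvectors

variable {k M : Type*} [Field k] [Field M] [Algebra k M]

theorem Matrix.eq_smul_of_mulVec_eq_smul {n : Type*} [Fintype n] [DecidableEq n]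
    {A B : Matrix n n M} {ev : n → M} (hev : Function.Injective ev) (hB : B.det ≠ 0)
    (hAB : ∀ i, A.mulVec (B i) = ev i • B i) {i : n} {w : n → M} (hw : A.mulVec w = ev i • w) :
    ∃ t : M, w = t • B i := by
  have hBt : IsUnit B.transpose := by
    rw [Matrix.isUnit_iff_isUnit_det, Matrix.det_transpose]; exact hB.isUnit
  obtain ⟨g, rfl⟩ := (Matrix.mulVec_surjective_iff_isUnit.2 hBt) w
  have key : ∀ g : n → M, B.transpose.mulVec g = ∑ j, g j • B j := by
    intro g
    ext l
    simp [Matrix.mulVec, dotProduct, mul_comm]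
  have h1 : B.transpose.mulVec (fun j => (ev j - ev i) * g j) = 0 := by
    rw [key, Matrix.mulVec_sum] at hw
    rw [key]
    simp only [sub_mul, sub_smul, Finset.sum_sub_distrib, sub_eq_zero]
    simp only [Matrix.mulVec_smul, hAB] at hw
    rw [Finset.smul_sum] at hw
    simpa [smul_smul, mul_comm] using hw
  have h2 := Matrix.eq_zero_of_mulVec_eq_zero (by rwa [Matrix.det_transpose]) h1
  refine ⟨g i, ?_⟩
  rw [key, Finset.sum_eq_single i]
  · intro j _ hj
    have := congrFun h2 j
    have h3 : ev j - ev i ≠ 0 := sub_ne_zero.2 fun h => hj (hev h)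
    simp only [Pi.zero_apply, mul_eq_zero, h3, false_or] at this
    simp [this]
  · simp

theorem apply_mem_of_mulVec_eq_smul {n : Type*} [Fintype n] [DecidableEq n]
    (K : IntermediateField k M) {A B : Matrix n n M} (hA : ∀ i j, A i j ∈ K) {ev : n → M}
    (hev : Function.Injective ev) (hB : B.det ≠ 0)
    (hAB : ∀ i, A.mulVec (B i) = ev i • B i) {i : n} (hi : ev i ∈ K) {j : n} (hj : B i j = 1)
    (l : n) : B i l ∈ K := by
  let A' : Matrix n n K := Matrix.of fun i j => ⟨A i j, hA i j⟩
  have hA' : A'.map (algebraMap K M) = A := by ext; rfl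
  let e : K := ⟨ev i, hi⟩
  have hBi : B i ≠ 0 := fun h0 => by simp [h0] at hj
  have h1 : (A' - Matrix.scalar n e).det = 0 := by
    apply (algebraMap K M).injective
    rw [map_zero, RingHom.map_det]
    apply Matrix.exists_mulVec_eq_zero_iff.1
    refine ⟨B i, hBi, ?_⟩
    have : (algebraMap K M).mapMatrix (A' - Matrix.scalar n e) = A - Matrix.scalar n (ev i) := by
      rw [map_sub, RingHom.mapMatrix_apply, hA']
      congr 1
      ext a b
      by_cases hab : a = b <;> simp [hab, e]
    rw [this, Matrix.sub_mulVec, hAB]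
    ext a
    simp
  obtain ⟨v, hv0, hv⟩ := Matrix.exists_mulVec_eq_zero_iff.2 h1
  obtain ⟨t, ht⟩ := Matrix.eq_smul_of_mulVec_eq_smul (i := i) hev hB hAB
    (w := fun a => (v a : M)) (by
      rw [Matrix.sub_mulVec, sub_eq_zero] at hv
      ext a
      have := congrArg (algebraMap K M) (congrFun hv a)
      simpa [Matrix.mulVec, dotProduct, Matrix.diagonal_apply, A', e,
        IntermediateField.algebraMap_apply] using this)
  have h2 : ∀ a, (v a : M) = t * B i a := fun a => congrFun ht a
  have htv : (v j : M) = t := by rw [h2, hj, mul_one]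
  have ht0 : t ≠ 0 := by
    rintro rfl
    apply hv0
    ext a
    simp [h2]
  have : B i l = v l / v j := by rw [h2, htv]; field_simp
  rw [this]
  exact div_mem (v l).2 (v j).2

theorem exists_monic_aeval_eq_zero_of_mulVec_eq_smul {n : Type*} [Fintype n] [DecidableEq n]
    (K : IntermediateField k M) {A : Matrix n n M} (hA : ∀ i j, A i j ∈ K) {v : n → M} {e : M}
    (hv0 : v ≠ 0) (hv : A.mulVec v = e • v) : ∃ p : Polynomial K, p.Monic ∧
      p.natDegree = Fintype.card n ∧ Polynomial.aeval e p = 0 := by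
  let A' : Matrix n n K := Matrix.of fun i j => ⟨A i j, hA i j⟩
  have hA' : A'.map (algebraMap K M) = A := by ext; rfl
  refine ⟨A'.charpoly, A'.charpoly_monic, A'.charpoly_natDegree_eq_dim, ?_⟩
  rw [Polynomial.aeval_def, Polynomial.eval₂_eq_eval_map, ← Matrix.charpoly_map, hA',
    Matrix.eval_charpoly]
  apply Matrix.exists_mulVec_eq_zero_iff.1
  refine ⟨v, hv0, ?_⟩
  rw [Matrix.sub_mulVec, hv]
  ext a
  simp

theorem injective_vec_four {α : Type*} {a b c d : α} (hab : a ≠ b) (hac : a ≠ c) (had : a ≠ d)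
    (hbc : b ≠ c) (hbd : b ≠ d) (hcd : c ≠ d) : Function.Injective ![a, b, c, d] := by
  intro i j hij
  fin_cases i <;> fin_cases j <;> simp_all

end Eigenvectors

namespace IsMonomialC4

variable {k M : Type*} [Field k] [Field M] [Algebra k M] {c : k} {σ : M ≃ₐ[k] M}
  {x₁ x₂ x₃ x₄ : M}

theorem det_ne_zero (h : IsMonomialC4 c σ x₁ x₂ x₃ x₄) (hc : c ≠ 0) :
    (!![1, x₁, x₁ * x₂, x₁ * x₂ * x₃; 1, x₂, x₂ * x₃, x₂ * x₃ * x₄;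
      1, x₃, x₃ * x₄, x₃ * x₄ * x₁; 1, x₄, x₄ * x₁, x₄ * x₁ * x₂] :
        Matrix (Fin 4) (Fin 4) M).det ≠ 0 := by
  have n1 := h.x₁_ne_zero
  have n2 := h.x₂_ne_zero
  have n3 := h.x₃_ne_zero
  refine h.ne_zero_of_eval (4 * C c ^ 2 * X 0 ^ 2 * X 1 * X 2 + 4 * C c * X 0 ^ 4 * X 1 ^ 3 * X 2 +
    2 * C c ^ 2 * X 0 ^ 2 * X 1 ^ 2 + C c ^ 2 * X 0 ^ 4 + X 0 ^ 4 * X 1 ^ 4 * X 2 ^ 4 - C c ^ 3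
    - C c * X 0 ^ 4 * X 1 ^ 4 - 2 * C c * X 0 ^ 4 * X 1 ^ 2 * X 2 ^ 2
    - 4 * C c ^ 2 * X 0 ^ 3 * X 1 - 4 * C c * X 0 ^ 3 * X 1 ^ 3 * X 2 ^ 2) ![0, 0, 0]
    (by simpa) fun h0 => ?_
  rw [h.x₄_eq] at h0
  simp [Matrix.det_succ_row_zero, Fin.sum_univ_succ, Fin.succAbove] at h0
  field_simp at h0
  simp [map_ofNat]
  linear_combination h0

theorem isRational_of_sq_eq_neg_one (h : IsMonomialC4 c σ x₁ x₂ x₃ x₄) (hc : c ≠ 0)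
    (hk : ringChar k ≠ 2) {i₀ : k} (hi₀ : i₀ ^ 2 = -1) :
    IsRational k (IntermediateField.fixedField (Subgroup.zpowers σ)) := by
  have h2 : (2 : M) ≠ 0 := h.ne_zero_of_ringChar hk
  have n1 := h.x₁_ne_zero
  have n2 := h.x₂_ne_zero
  have n3 := h.x₃_ne_zero
  have e1 := h.map₁
  have e2 := h.map₂
  have e3 := h.map₃
  have e4 := h.map₄
  obtain ⟨ι, hι⟩ : ∃ z, z = algebraMap k M i₀ := ⟨_, rfl⟩
  have sι : σ ι = ι := by rw [hι]; simp
  have hι2 : ι ^ 2 = -1 := by rw [hι, ← map_pow, hi₀]; simp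
  have hi0 : i₀ ≠ 0 := by rintro rfl; simp at hi₀
  obtain ⟨c', hc'⟩ : ∃ z, z = algebraMap k M c := ⟨_, rfl⟩
  have sc : σ c' = c' := by rw [hc']; simp
  have hp : x₁ * x₂ * x₃ * x₄ = c' := by rw [hc', h.prod]
  let B : Matrix (Fin 4) (Fin 4) M :=
    !![1, x₁, x₁ * x₂, x₁ * x₂ * x₃; 1, x₂, x₂ * x₃, x₂ * x₃ * x₄;
      1, x₃, x₃ * x₄, x₃ * x₄ * x₁; 1, x₄, x₄ * x₁, x₄ * x₁ * x₂]
  have hB : B.det ≠ 0 := h.det_ne_zero hc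
  have hBσ : ∀ i j, σ (B i j) = B (i + 1) j := by
    intro i j
    fin_cases i <;> fin_cases j <;> simp [B, e1, e2, e3, e4]
  let F := IntermediateField.fixedField (Subgroup.zpowers σ)
  have hF : ∀ z : F, σ z = z := fun z => mem_fixedField (z : M) |>.1 z.2
  have hli : LinearIndependent F (B 0) := by
    rw [Fintype.linearIndependent_iff]
    intro g hg i
    have hs : ∀ m : Fin 4, ∑ j, (g j : M) * B m j = 0 := by
      have hstep : ∀ m : Fin 4, ∑ j, (g j : M) * B m j = 0 →
          ∑ j, (g j : M) * B (m + 1) j = 0 := by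
        intro m hm
        have := congrArg σ hm
        simpa [hF, hBσ] using this
      have h0 : ∑ j, (g j : M) * B 0 j = 0 := by
        simpa [Algebra.smul_def, IntermediateField.algebraMap_apply] using hg
      have h1 := hstep 0 h0
      have h2 := hstep 1 h1
      have h3 := hstep 2 h2
      intro m
      fin_cases m
      · exact h0
      · exact h1
      · exact h2
      · exact h3
    have h3 : B.mulVec (fun j => (g j : M)) = 0 := by
      ext m
      simpa [Matrix.mulVec, dotProduct, mul_comm] using hs m
    have := congrFun (Matrix.eq_zero_of_mulVec_eq_zero hB h3) i
    simpa using this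
  obtain ⟨θ₀, hθ₀⟩ : ∃ z, z = x₁ - ι * x₂ - x₃ + ι * x₄ := ⟨_, rfl⟩
  have sθ₀ : σ θ₀ = ι * θ₀ := by
    rw [hθ₀]
    simp only [map_add, map_sub, map_mul, sι, e1, e2, e3, e4]
    linear_combination (x₂ - x₄) * hι2
  have hθ₀0 : θ₀ ≠ 0 := by
    refine h.ne_zero_of_eval (C i₀ * C c + X 0 ^ 2 * X 1 * X 2 - C i₀ * X 0 * X 1 ^ 2 * X 2 -
      X 0 * X 1 * X 2 ^ 2) ![0, 0, 0] (by simp [hi0, hc]) fun h0 => ?_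
    rw [hθ₀, h.x₄_eq] at h0
    field_simp at h0
    simp [← hι]
    linear_combination h0
  have hfd : FiniteDimensional F M := h.finite_fixedField
  let bas := basisOfLinearIndependentOfCardEqFinrank hli (by rw [h.finrank_fixedField]; simp)
  obtain ⟨γ, hγ⟩ : ∃ γ : Fin 4 → F, ∑ j, (γ j : M) * B 0 j = θ₀ := by
    refine ⟨fun j => bas.repr θ₀ j, ?_⟩
    have := bas.sum_repr θ₀
    simpa [bas, Algebra.smul_def, IntermediateField.algebraMap_apply] using this
  obtain ⟨j₀, hj₀⟩ : ∃ j, (γ j : M) ≠ 0 := by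
    by_contra! hall
    apply hθ₀0
    rw [← hγ]
    simp [hall]
  obtain ⟨r, hr⟩ : ∃ r : Fin 4 → M, ∀ j, r j = γ j / γ j₀ := ⟨_, fun _ => rfl⟩
  have sr : ∀ j, σ (r j) = r j := by intro j; rw [hr]; simp [hF]
  obtain ⟨θ, hθ⟩ : ∃ z, z = θ₀ / γ j₀ := ⟨_, rfl⟩
  have sθ : σ θ = ι * θ := by rw [hθ, map_div₀, sθ₀, hF, mul_div_assoc]
  have hθ0 : θ ≠ 0 := by rw [hθ]; exact div_ne_zero hθ₀0 hj₀
  have E0 : r 0 + r 1 * x₁ + r 2 * (x₁ * x₂) + r 3 * (x₁ * x₂ * x₃) = θ := by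
    rw [hθ, ← hγ]
    simp [hr, Fin.sum_univ_succ, B]
    field_simp
    ring
  have E1 : r 0 + r 1 * x₂ + r 2 * (x₂ * x₃) + r 3 * (x₂ * x₃ * x₄) = ι * θ := by
    have := congrArg σ E0
    simpa only [map_add, map_mul, sr, e1, e2, e3, e4, sθ] using this
  have E2 : r 0 + r 1 * x₃ + r 2 * (x₃ * x₄) + r 3 * (x₃ * x₄ * x₁) = -θ := by
    have := congrArg σ E1
    simp only [map_add, map_mul, sr, e2, e3, e4, sθ, sι] at this
    linear_combination this + θ * hι2
  have E3 : r 0 + r 1 * x₄ + r 2 * (x₄ * x₁) + r 3 * (x₄ * x₁ * x₂) = -(ι * θ) := by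
    have := congrArg σ E2
    simpa only [map_add, map_mul, sr, e1, e2, e3, e4, sθ, map_neg] using this
  let A : Matrix (Fin 4) (Fin 4) M :=
    !![r 0, r 1, r 2, r 3;
      -ι * c' * r 3, -ι * r 0, -ι * r 1, -ι * r 2;
      -c' * r 2, -c' * r 3, -r 0, -r 1;
      ι * c' * r 1, ι * c' * r 2, ι * c' * r 3, ι * r 0]
  have sA : ∀ i j, σ (A i j) = A i j := by
    intro i j
    fin_cases i <;> fin_cases j <;> simp [A, sr, sι, sc]
  have hA0 : A.mulVec (B 0) = θ • B 0 := by
    ext j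
    fin_cases j
    · simp [A, B, Matrix.mulVec, dotProduct, Fin.sum_univ_succ]
      linear_combination E0
    · simp [A, B, Matrix.mulVec, dotProduct, Fin.sum_univ_succ]
      linear_combination ι * r 3 * hp - ι * x₁ * E1 - θ * x₁ * hι2
    · simp [A, B, Matrix.mulVec, dotProduct, Fin.sum_univ_succ]
      linear_combination (r 2 + r 3 * x₁) * hp - x₁ * x₂ * E2
    · simp [A, B, Matrix.mulVec, dotProduct, Fin.sum_univ_succ]
      linear_combination -ι * (r 1 + r 2 * x₁ + r 3 * (x₁ * x₂)) * hp + ι * x₁ * x₂ * x₃ * E3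
        - θ * x₁ * x₂ * x₃ * hι2
  have hAstep : ∀ (m : Fin 4) (z : M), A.mulVec (B m) = z • B m →
      A.mulVec (B (m + 1)) = σ z • B (m + 1) := by
    intro m z hm
    ext j
    have := congrArg σ (congrFun hm j)
    simpa [Matrix.mulVec, dotProduct, sA, hBσ] using this
  have hA1 := hAstep 0 _ hA0
  have hA2 := hAstep 1 _ hA1
  have hA3 := hAstep 2 _ hA2
  have hev : Function.Injective ![θ, σ θ, σ (σ θ), σ (σ (σ θ))] := by
    have q1 : σ θ = ι * θ := sθ
    have q2 : σ (σ θ) = -θ := by rw [q1, map_mul, sι, q1]; linear_combination θ * hι2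
    have q3 : σ (σ (σ θ)) = -(ι * θ) := by rw [q2, map_neg, q1]
    have hιs : (ι - 1) * (ι + 1) ≠ 0 := by
      rw [show (ι - 1) * (ι + 1) = -2 by linear_combination hι2]; exact neg_ne_zero.2 h2
    have hι1 : ι - 1 ≠ 0 := left_ne_zero_of_mul hιs
    have hι1' : ι + 1 ≠ 0 := right_ne_zero_of_mul hιs
    have hι0 : ι ≠ 0 := by rintro rfl; simp at hι2
    rw [q3, q2, q1]
    have d01 : θ ≠ ι * θ := fun h => mul_ne_zero hι1 hθ0 (by linear_combination -h)
    have d02 : θ ≠ -θ := fun h => mul_ne_zero h2 hθ0 (by linear_combination h)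
    have d03 : θ ≠ -(ι * θ) := fun h => mul_ne_zero hι1' hθ0 (by linear_combination h)
    have d12 : ι * θ ≠ -θ := fun h => mul_ne_zero hι1' hθ0 (by linear_combination h)
    have d13 : ι * θ ≠ -(ι * θ) := fun h =>
      mul_ne_zero (mul_ne_zero h2 hι0) hθ0 (by linear_combination h)
    have d23 : -θ ≠ -(ι * θ) := fun h => mul_ne_zero hι1 hθ0 (by linear_combination h)
    exact injective_vec_four d01 d02 d03 d12 d13 d23
  have hAB : ∀ i, A.mulVec (B i) = ![θ, σ θ, σ (σ θ), σ (σ (σ θ))] i • B i := by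
    intro i
    fin_cases i
    · exact hA0
    · exact hA1
    · exact hA2
    · exact hA3
  have hrj : r j₀ = 1 := by rw [hr]; exact div_self hj₀
  have hL : ∀ K : IntermediateField k M, IntermediateField.adjoin k (Set.range ![r (j₀.succAbove 0),
      r (j₀.succAbove 1), r (j₀.succAbove 2)]) ≤ K → ∀ i j, A i j ∈ K := by
    intro K hK
    have h5 := fun i => hK (IntermediateField.subset_adjoin k _ ⟨i, rfl⟩)
    have h6 : ∀ j, r j ∈ K := by
      intro j
      rcases Fin.eq_self_or_eq_succAbove j₀ j with rfl | ⟨i, rfl⟩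
      · rw [hrj]; exact one_mem K
      · fin_cases i
        · exact h5 0
        · exact h5 1
        · exact h5 2
    have mι : ι ∈ K := hι ▸ K.algebraMap_mem i₀
    have mc : c' ∈ K := hc' ▸ K.algebraMap_mem c
    intro i j
    fin_cases i <;> fin_cases j <;> simp [A, h6] <;>
      repeat' first | assumption | apply h6 | apply neg_mem | apply mul_mem
  obtain ⟨p, hpm, hpd, hp0⟩ := exists_monic_aeval_eq_zero_of_mulVec_eq_smul _ (hL _ le_rfl)
    (v := B 0) (fun h0 => by simpa [B] using congrFun h0 0) hA0
  refine h.isRational_of_finrank_le (sr _) (sr _) (sr _) (finrank_le_of_root hpm.ne_zero hp0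
    (by simp [hpd]) (IntermediateField.adjoin_singleton_eq_top_of_forall _ ?_))
  intro K hK mθ
  have key := apply_mem_of_mulVec_eq_smul K (hL K hK) hev hB hAB (i := 0) mθ (j := 0) rfl
  have m₁ : x₁ ∈ K := key 1
  have m₂ : x₁ * x₂ ∈ K := key 2
  have m₃ : x₁ * x₂ * x₃ ∈ K := key 3
  refine h.eq_top_of_mem m₁ ?_ ?_
  · rw [show x₂ = x₁ * x₂ / x₁ by field_simp]; exact div_mem m₂ m₁
  · rw [show x₃ = x₁ * x₂ * x₃ / (x₁ * x₂) by field_simp]; exact div_mem m₃ m₂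

end IsMonomialC4

theorem exists_isUnit_map_eq_mul {A K : Type*} [CommRing A] [IsDomain A]
    [UniqueFactorizationMonoid A] [Field K] [Algebra A K] [IsFractionRing A K] {s : K ≃+* K}
    {s' : A ≃+* A} (hs : ∀ a, s (algebraMap A K a) = algebraMap A K (s' a)) {u : A}
    (hu : IsUnit u) {η : K} (hη : η * s η = algebraMap A K u) :
    ∃ (P Q : A) (v : A), P ≠ 0 ∧ Q ≠ 0 ∧ IsUnit v ∧ s' P = v * Q ∧ v * P = u * s' Q := by
  obtain ⟨P, ⟨Q, hQ⟩, hPQ, rfl⟩ := IsFractionRing.exists_reduced_fraction A η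
  have hQ0 : Q ≠ 0 := nonZeroDivisors.ne_zero hQ
  have hs0 : s' Q ≠ 0 := by simpa using hQ0
  have hinj := IsFractionRing.injective A K
  have h1 : P * s' P = u * (Q * s' Q) := by
    apply hinj
    rw [IsFractionRing.mk'_eq_div, map_div₀, hs, hs] at hη
    have hQ' : algebraMap A K Q ≠ 0 := by simpa using hQ0
    have hs' : algebraMap A K (s' Q) ≠ 0 := by simpa using hs0
    field_simp at hη
    simp only [map_mul]
    linear_combination hη
  have hP0 : P ≠ 0 := by
    rintro rfl
    rw [map_zero, zero_mul] at h1
    exact mul_ne_zero hu.ne_zero (mul_ne_zero hQ0 hs0) h1.symm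
  have hrel : IsRelPrime (s' P) (s' Q) := by
    intro d hd hd'
    have := hPQ (d := s'.symm d) (by simpa using map_dvd s'.symm hd)
      (by simpa using map_dvd s'.symm hd')
    simpa using this.map s'
  have d1 : Q ∣ s' P := by
    apply hPQ.symm.dvd_of_dvd_mul_left
    rw [h1]
    exact ⟨u * s' Q, by ring⟩
  have d2 : s' P ∣ Q := by
    have : s' P ∣ u * Q := by
      apply hrel.dvd_of_dvd_mul_right
      rw [mul_assoc, ← h1]
      exact dvd_mul_left _ _
    exact (hu.dvd_mul_left).1 this
  obtain ⟨v, hv⟩ := associated_of_dvd_dvd d1 d2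
  refine ⟨P, Q, v, hP0, hQ0, v.isUnit, by rw [← hv, mul_comm], ?_⟩
  apply mul_right_cancel₀ hQ0
  rw [← hv] at h1
  linear_combination h1

namespace IsMonomialC4

variable {k M : Type*} [Field k] [Field M] [Algebra k M] {c : k} {σ : M ≃ₐ[k] M}
  {x₁ x₂ x₃ x₄ : M}

/-- The `k`-subalgebra of Laurent polynomials in `x₁, x₂, x₃`. -/
def laurent (k : Type*) {M : Type*} [Field k] [Field M] [Algebra k M] (x₁ x₂ x₃ : M) :
    Subalgebra k M :=
  Algebra.adjoin k {x₁, x₂, x₃, (x₁ * x₂ * x₃)⁻¹}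

theorem mem_laurent_iff (h : IsMonomialC4 c σ x₁ x₂ x₃ x₄) {z : M} : z ∈ laurent k x₁ x₂ x₃ ↔
    ∃ (n : ℕ) (p : MvPolynomial (Fin 3) k), z * (x₁ * x₂ * x₃) ^ n = aeval ![x₁, x₂, x₃] p := by
  have n1 := h.x₁_ne_zero
  have n2 := h.x₂_ne_zero
  have n3 := h.x₃_ne_zero
  have hμ : aeval ![x₁, x₂, x₃] (X 0 * X 1 * X 2 : MvPolynomial (Fin 3) k) = x₁ * x₂ * x₃ := by
    simp
  constructor
  · intro hz
    induction hz using Algebra.adjoin_induction with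
    | mem x hx =>
      rcases hx with rfl | rfl | rfl | rfl
      · exact ⟨0, X 0, by simp⟩
      · exact ⟨0, X 1, by simp⟩
      · exact ⟨0, X 2, by simp⟩
      · exact ⟨1, 1, by simp; field_simp⟩
    | algebraMap r => exact ⟨0, C r, by simp⟩
    | add x y _ _ hx hy =>
      obtain ⟨n, p, hp⟩ := hx
      obtain ⟨m, q, hq⟩ := hy
      refine ⟨n + m, p * (X 0 * X 1 * X 2) ^ m + q * (X 0 * X 1 * X 2) ^ n, ?_⟩
      rw [map_add, map_mul, map_mul, ← hp, ← hq, map_pow, map_pow, hμ]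
      ring
    | mul x y _ _ hx hy =>
      obtain ⟨n, p, hp⟩ := hx
      obtain ⟨m, q, hq⟩ := hy
      refine ⟨n + m, p * q, ?_⟩
      rw [map_mul, ← hp, ← hq]
      ring
  · rintro ⟨n, p, hp⟩
    have hz : z = aeval ![x₁, x₂, x₃] p * (x₁ * x₂ * x₃)⁻¹ ^ n := by
      rw [← hp, inv_pow]; field_simp
    have hm := fun i => Algebra.subset_adjoin (R := k) (s := {x₁, x₂, x₃, (x₁ * x₂ * x₃)⁻¹}) (a := i)
    rw [hz]
    refine mul_mem ?_ (pow_mem (hm _ (by simp)) n)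
    have : aeval ![x₁, x₂, x₃] p ∈ (aeval (R := k) ![x₁, x₂, x₃]).range := ⟨p, rfl⟩
    rw [← Algebra.adjoin_range_eq_range_aeval] at this
    refine Algebra.adjoin_mono ?_ this
    rintro _ ⟨i, rfl⟩
    fin_cases i <;> simp

theorem map_mem_laurent (h : IsMonomialC4 c σ x₁ x₂ x₃ x₄) (hc : c ≠ 0) {z : M}
    (hz : z ∈ laurent k x₁ x₂ x₃) : σ z ∈ laurent k x₁ x₂ x₃ := by
  have n1 := h.x₁_ne_zero
  have n2 := h.x₂_ne_zero
  have n3 := h.x₃_ne_zero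
  have n4 := h.x₄_ne_zero
  have hc' : algebraMap k M c ≠ 0 := by simpa
  have hm := fun i => Algebra.subset_adjoin (R := k) (s := {x₁, x₂, x₃, (x₁ * x₂ * x₃)⁻¹}) (a := i)
  induction hz using Algebra.adjoin_induction with
  | mem x hx =>
    rcases hx with rfl | rfl | rfl | rfl
    · rw [h.map₁]; exact hm _ (by simp)
    · rw [h.map₂]; exact hm _ (by simp)
    · rw [h.map₃, h.x₄_eq, div_eq_mul_inv]
      exact mul_mem (Subalgebra.algebraMap_mem _ c) (hm _ (by simp))
    · have : σ (x₁ * x₂ * x₃)⁻¹ = algebraMap k M c⁻¹ * x₁ := by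
        simp only [map_inv₀, map_mul, h.map₁, h.map₂, h.map₃]
        field_simp
        rw [← h.prod]
        ring
      rw [this]
      exact mul_mem (Subalgebra.algebraMap_mem _ _) (hm _ (by simp))
  | algebraMap r => rw [AlgEquiv.commutes]; exact Subalgebra.algebraMap_mem _ r
  | add x y _ _ hx hy => rw [map_add]; exact add_mem hx hy
  | mul x y _ _ hx hy => rw [map_mul]; exact mul_mem hx hy

theorem uniqueFactorizationMonoid_laurent (h : IsMonomialC4 c σ x₁ x₂ x₃ x₄) :
    UniqueFactorizationMonoid (laurent k x₁ x₂ x₃) := by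
  have n1 := h.x₁_ne_zero
  have n2 := h.x₂_ne_zero
  have n3 := h.x₃_ne_zero
  have hmem : ∀ p : MvPolynomial (Fin 3) k, aeval ![x₁, x₂, x₃] p ∈ laurent k x₁ x₂ x₃ :=
    fun p => h.mem_laurent_iff.2 ⟨0, p, by simp⟩
  let f : MvPolynomial (Fin 3) k →ₐ[k] laurent k x₁ x₂ x₃ :=
    (aeval ![x₁, x₂, x₃]).codRestrict _ hmem
  algebraize [f.toRingHom]
  have hf : ∀ p, (algebraMap (MvPolynomial (Fin 3) k) (laurent k x₁ x₂ x₃) p : M) =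
    aeval ![x₁, x₂, x₃] p := fun p => rfl
  have : IsLocalization (Submonoid.powers (X 0 * X 1 * X 2 : MvPolynomial (Fin 3) k))
      (laurent k x₁ x₂ x₃) := by
    refine ⟨?_, ?_, ?_⟩
    · rintro ⟨_, n, rfl⟩
      simp only [map_pow]
      apply IsUnit.pow
      rw [isUnit_iff_exists_inv]
      refine ⟨⟨(x₁ * x₂ * x₃)⁻¹, Algebra.subset_adjoin (by simp)⟩, ?_⟩
      ext
      simp [hf]
      field_simp
    · intro z
      obtain ⟨n, p, hp⟩ := h.mem_laurent_iff.1 z.2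
      refine ⟨⟨p, ⟨_, n, rfl⟩⟩, ?_⟩
      ext
      simp [hf, ← hp]
    · intro p q hpq
      refine ⟨1, ?_⟩
      have := congrArg Subtype.val hpq
      rw [hf, hf] at this
      rw [h.indep this]
  exact UniqueFactorizationMonoid.of_isLocalization
    (Submonoid.powers (X 0 * X 1 * X 2 : MvPolynomial (Fin 3) k)) _

theorem isFractionRing_laurent (h : IsMonomialC4 c σ x₁ x₂ x₃ x₄) :
    IsFractionRing (laurent k x₁ x₂ x₃) M := by
  refine IsFractionRing.of_field _ _ fun z => ?_
  have hz : z ∈ IntermediateField.adjoin k (Set.range ![x₁, x₂, x₃]) := by rw [h.gen]; trivial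
  obtain ⟨p, q, rfl⟩ := (IntermediateField.mem_adjoin_range_iff k _ _).1 hz
  exact ⟨⟨aeval ![x₁, x₂, x₃] p, h.mem_laurent_iff.2 ⟨0, p, by simp⟩⟩,
    ⟨aeval ![x₁, x₂, x₃] q, h.mem_laurent_iff.2 ⟨0, q, by simp⟩⟩, rfl⟩

theorem exists_norm_eq_of_mul_eq_one (h : IsMonomialC4 c σ x₁ x₂ x₃ x₄) {v w : M}
    (hv : v ∈ laurent k x₁ x₂ x₃) (hw : w ∈ laurent k x₁ x₂ x₃) (hvw : v * w = 1) :
    ∃ (a : k) (m n : ℕ), v * σ v * σ (σ v) * σ (σ (σ v)) * algebraMap k M c ^ n =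
      algebraMap k M (a ^ 4 * c ^ m) := by
  have e1 := h.map₁
  have e2 := h.map₂
  have e3 := h.map₃
  have e4 := h.map₄
  obtain ⟨n, p, hp⟩ := h.mem_laurent_iff.1 hv
  obtain ⟨m, q, hq⟩ := h.mem_laurent_iff.1 hw
  have hpq : p * q = (X 0 * X 1 * X 2) ^ (n + m) := by
    apply h.indep
    have : aeval ![x₁, x₂, x₃] (p * q) = aeval ![x₁, x₂, x₃]
        ((X 0 * X 1 * X 2 : MvPolynomial (Fin 3) k) ^ (n + m)) := by
      rw [map_mul, ← hp, ← hq]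
      simp
      linear_combination (x₁ * x₂ * x₃) ^ (n + m) * hvw
    exact this
  have hmon : (X 0 * X 1 * X 2 : MvPolynomial (Fin 3) k) ^ (n + m) =
      monomial ((n + m) • (Finsupp.single 0 1 + Finsupp.single 1 1 + Finsupp.single 2 1)) 1 := by
    simp [X, monomial_mul, monomial_pow]
  obtain ⟨s, a, -, -, rfl⟩ := (dvd_monomial_one_iff_exists (p := p)).1 ⟨q, by rw [← hmon, hpq]⟩
  refine ⟨a, s 0 + s 1 + s 2, 3 * n, ?_⟩
  have hp' : v * (x₁ * x₂ * x₃) ^ n = algebraMap k M a * (x₁ ^ s 0 * x₂ ^ s 1 * x₃ ^ s 2) := by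
    rw [hp, aeval_monomial, Finsupp.prod_fintype _ _ (by simp), Fin.prod_univ_three]
    rfl
  have h1 := congrArg σ hp'
  have h2 := congrArg σ h1
  have h3 := congrArg σ h2
  simp only [map_mul, map_pow, e1, e2, e3, e4, AlgEquiv.commutes] at h1 h2 h3
  have h4 : v * σ v * σ (σ v) * σ (σ (σ v)) * (x₁ * x₂ * x₃ * x₄) ^ (3 * n) =
      algebraMap k M a ^ 4 * (x₁ * x₂ * x₃ * x₄) ^ (s 0 + s 1 + s 2) := by
    calc _ = (v * (x₁ * x₂ * x₃) ^ n) * (σ v * (x₂ * x₃ * x₄) ^ n) *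
          (σ (σ v) * (x₃ * x₄ * x₁) ^ n) * (σ (σ (σ v)) * (x₄ * x₁ * x₂) ^ n) := by ring
      _ = _ := by rw [hp', h1, h2, h3]; ring
  rw [h.prod] at h4
  rw [h4]
  simp

theorem norm_four_contradiction {k : Type*} [Field k] {e a : k} {m n : ℕ} (he : ¬ IsSquare e)
    (he' : ¬ IsSquare (-e)) (h1 : ¬ IsSquare (-1 : k)) (h2 : (2 : k) ≠ 0)
    (h : e ^ 2 * (-4 * e ^ 2) ^ n = a ^ 4 * (-4 * e ^ 2) ^ m) : False := by
  have he0 : e ≠ 0 := by rintro rfl; simp at he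
  have hc : -4 * e ^ 2 = -(2 * e) ^ 2 := by ring
  rw [hc] at h
  have h2e : 2 * e ≠ 0 := mul_ne_zero h2 he0
  obtain ⟨t, ht⟩ : ∃ t, t = 2 * e := ⟨_, rfl⟩
  rw [← ht] at h h2e
  have ha : a ≠ 0 := by
    rintro rfl
    rw [zero_pow (by norm_num), zero_mul, mul_eq_zero] at h
    simp [he0, h2e] at h
  have key : ∀ i j : ℕ, (e * t ^ (2 * i)) ^ 2 = (a ^ 2 * t ^ (2 * j)) ^ 2 → False := by
    intro i j hij
    rcases sq_eq_sq_iff_eq_or_eq_neg.1 hij with h | h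
    · exact he ⟨a * t ^ j / t ^ i, by field_simp; linear_combination h⟩
    · exact he' ⟨a * t ^ j / t ^ i, by field_simp; linear_combination -h⟩
  have key' : (e * t ^ n) ^ 2 = -(a ^ 2 * t ^ m) ^ 2 → False := fun hij =>
    h1 ⟨e * t ^ n / (a ^ 2 * t ^ m), by field_simp; linear_combination -hij⟩
  rcases Nat.even_or_odd n with hn | hn <;> rcases Nat.even_or_odd m with hm | hm
  · rw [hn.neg_pow, hm.neg_pow] at h
    obtain ⟨i, rfl⟩ := hn
    obtain ⟨j, rfl⟩ := hm
    exact key i j (by linear_combination h)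
  · rw [hn.neg_pow, hm.neg_pow] at h
    exact key' (by linear_combination h)
  · rw [hn.neg_pow, hm.neg_pow] at h
    exact key' (by linear_combination -h)
  · rw [hn.neg_pow, hm.neg_pow] at h
    obtain ⟨i, rfl⟩ := hn
    obtain ⟨j, rfl⟩ := hm
    refine key i j (mul_right_cancel₀ (pow_ne_zero 2 h2e) ?_)
    linear_combination -h

theorem mul_map_ne (h : IsMonomialC4 c σ x₁ x₂ x₃ x₄) {e : k} (hce : c = -4 * e ^ 2)
    (he : ¬ IsSquare e) (he' : ¬ IsSquare (-e)) (h1 : ¬ IsSquare (-1 : k)) (h2 : (2 : k) ≠ 0)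
    (η : M) : η * σ η ≠ algebraMap k M e := by
  intro hη
  have he0 : e ≠ 0 := by rintro rfl; simp at he
  have h4 : (4 : k) ≠ 0 := by rw [show (4 : k) = 2 ^ 2 by norm_num]; positivity
  have hc : c ≠ 0 := by rw [hce]; simp [he0, h4]
  have := h.uniqueFactorizationMonoid_laurent
  have := h.isFractionRing_laurent
  have hσ3 : ∀ z ∈ laurent k x₁ x₂ x₃, σ (σ (σ z)) ∈ laurent k x₁ x₂ x₃ := fun z hz =>
    h.map_mem_laurent hc (h.map_mem_laurent hc (h.map_mem_laurent hc hz))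
  let s' : laurent k x₁ x₂ x₃ ≃+* laurent k x₁ x₂ x₃ :=
    { toFun z := ⟨σ z, h.map_mem_laurent hc z.2⟩
      invFun z := ⟨σ (σ (σ z)), hσ3 _ z.2⟩
      left_inv z := by ext; simp [h.apply_four]
      right_inv z := by ext; simp [h.apply_four]
      map_mul' x y := by ext; simp
      map_add' x y := by ext; simp }
  have hs : ∀ z, (s' z : M) = σ z := fun z => rfl
  obtain ⟨P, Q, v, hP, hQ, hv, hPQ, hPQ'⟩ := exists_isUnit_map_eq_mul (A := laurent k x₁ x₂ x₃)
    (K := M) (s := σ.toRingEquiv) (s' := s') (fun _ => rfl)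
    (u := algebraMap k _ e) ((IsUnit.mk0 e he0).map _) (η := η) hη
  obtain ⟨w, hvw⟩ := hv.exists_right_inv
  obtain ⟨a, m, n, hN⟩ := h.exists_norm_eq_of_mul_eq_one v.2 w.2 (by exact_mod_cast congrArg Subtype.val hvw)
  have E1 := congrArg Subtype.val hPQ
  have E2 := congrArg Subtype.val hPQ'
  obtain ⟨p, hp⟩ : ∃ z, z = (P : M) := ⟨_, rfl⟩
  obtain ⟨q, hq⟩ : ∃ z, z = (Q : M) := ⟨_, rfl⟩
  obtain ⟨y, hy⟩ : ∃ z, z = (v : M) := ⟨_, rfl⟩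
  obtain ⟨e', he''⟩ : ∃ z, z = algebraMap k M e := ⟨_, rfl⟩
  have se : σ e' = e' := by rw [he'']; simp
  have hp0 : p ≠ 0 := by rw [hp]; simpa using hP
  have he'0 : e' ≠ 0 := by rw [he'']; simpa
  have E1' : σ p = y * q := by rw [hp, hq, hy]; exact E1
  have E2' : y * p = e' * σ q := by rw [hp, hq, hy, he'']; exact E2
  have E3 : e' * σ (σ p) = σ y * y * p := by
    rw [E1', map_mul]; linear_combination -σ y * E2'
  have E4 := congrArg (fun z => σ (σ z)) E3
  simp only [map_mul, se, h.apply_four] at E4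
  have E5 : y * σ y * σ (σ y) * σ (σ (σ y)) = e' ^ 2 := by
    apply mul_right_cancel₀ hp0
    linear_combination -e' * E4 - σ (σ (σ y)) * σ (σ y) * E3
  rw [hy] at E5
  rw [E5, he'', ← map_pow, ← map_pow, ← map_mul] at hN
  have hN' := (algebraMap k M).injective hN
  rw [hce] at hN'
  exact norm_four_contradiction he he' h1 h2 hN'

end IsMonomialC4

theorem Valuation.exists_map_sq_sub_lt_one {K Γ₀ : Type*} [Field K]
    [LinearOrderedCommGroupWithZero Γ₀] (v : Valuation K Γ₀) {a b e T U W η : K}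
    (h2 : v 2 = 1) (he : v e = 1) (hab : a = b ^ 2 + 1)
    (hη : η ^ 2 + 4 * e ^ 2 = a * (b * T) ^ 2) (hU : U ^ 2 - a * W ^ 2 = η + a * T)
    (hv : ∀ z, v a ≠ v z ^ 2) : ∃ z, v (z ^ 2 - e) < 1 := by
  have hv' : ∀ x y, y ≠ 0 → v x ^ 2 ≠ v a * v y ^ 2 := by
    intro x y hy hxy
    apply hv (x / y)
    rw [map_div₀, div_pow, hxy, mul_div_cancel_right₀]
    exact pow_ne_zero _ (v.ne_zero_iff.mpr hy)
  have hlt : ∀ x, v x ^ 2 < 1 → v x < 1 := fun x hx ↦ (pow_lt_one_iff two_ne_zero).mp hx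
  have h4 : v (4 * e ^ 2) = 1 := by
    rw [show (4 : K) = 2 ^ 2 by norm_num]
    simp [h2, he]
  have hb1 : v b ≤ 1 := by
    by_contra! hb
    apply hv b
    rw [hab, Valuation.map_add_eq_of_lt_left, map_pow]
    rw [map_one, map_pow]
    exact one_lt_pow₀ hb two_ne_zero
  have ha : v a < 1 := by
    refine lt_of_le_of_ne ?_ (fun h ↦ hv 1 (by simpa using h))
    rw [hab]
    refine v.map_add_le ?_ v.map_one.le
    rw [map_pow]
    exact pow_le_one₀ zero_le hb1
  have hb : v b = 1 := by
    refine le_antisymm hb1 ?_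
    by_contra! hb
    have : v (b ^ 2) < v 1 := by
      rw [map_pow, map_one]
      exact pow_lt_one₀ zero_le hb two_ne_zero
    rw [hab, Valuation.map_add_eq_of_lt_right _ this, map_one] at ha
    exact ha.ne rfl
  have hη1 : v η ≤ 1 := by
    by_contra! h
    have h' : v (4 * e ^ 2) < v (η ^ 2) := by
      rw [h4, map_pow]
      exact one_lt_pow₀ h two_ne_zero
    have h'' := Valuation.map_add_eq_of_lt_left v h'
    rw [hη, map_mul, map_pow, map_pow] at h''
    refine hv' η (b * T) ?_ h''.symm
    intro h0
    rw [h0, map_zero, zero_pow two_ne_zero, mul_zero, eq_comm, ← map_pow] at h''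
    rw [h''] at h'
    exact not_lt_zero h'
  have haT2 : v (a * T ^ 2) < 1 := by
    refine lt_of_le_of_ne ?_ ?_
    · have h' : v (η ^ 2 + 4 * e ^ 2) ≤ 1 := by
        refine v.map_add_le ?_ h4.le
        rw [map_pow]
        exact pow_le_one₀ zero_le hη1
      rwa [hη, map_mul, map_pow, map_mul, hb, one_mul, ← map_pow, ← map_mul] at h'
    · intro h'
      have hT : T ≠ 0 := by rintro rfl; simp at h'
      rw [map_mul, map_pow] at h'
      exact hv' 1 T hT (by simpa using h'.symm)
  have haT : v (a * T) < 1 := by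
    apply hlt
    rw [← map_pow, mul_pow, sq a, mul_assoc, map_mul]
    exact mul_lt_one' ha haT2
  have hηe : v (η ^ 2 + 4 * e ^ 2) < 1 := by
    rw [hη, mul_pow, mul_left_comm, map_mul, map_pow, hb, one_pow, one_mul]
    exact haT2
  have hη0 : v η = 1 := by
    refine le_antisymm hη1 ?_
    by_contra! h
    have : v (η ^ 2) < v (4 * e ^ 2) := by
      rw [h4, map_pow]
      exact pow_lt_one₀ zero_le h two_ne_zero
    rw [Valuation.map_add_eq_of_lt_right _ this, h4] at hηe
    exact hηe.ne rfl
  have hηT : v (η + a * T) = 1 := by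
    rw [Valuation.map_add_eq_of_lt_left _ (by rwa [hη0]), hη0]
  have hW : v (a * W ^ 2) < 1 := by
    by_contra! hW
    have hW0 : W ≠ 0 := by rintro rfl; simp at hW
    rcases lt_trichotomy (v (U ^ 2)) (v (a * W ^ 2)) with h | h | h
    · rw [← hU, v.map_sub_eq_of_lt_right h, map_mul, map_pow] at hηT
      exact hv' 1 W hW0 (by simpa using hηT.symm)
    · rw [map_mul, map_pow, map_pow] at h
      exact hv' U W hW0 h
    · rw [← hU, v.map_sub_eq_of_lt_left h] at hηT
      exact absurd (hW.trans_lt h) hηT.not_gt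
  have hUη : v (U ^ 2 - η) < 1 := by
    rw [show U ^ 2 - η = a * W ^ 2 + a * T by linear_combination hU]
    exact v.map_add_lt hW haT
  have hmul : v ((η - 2 * b * e) * (η + 2 * b * e)) < 1 := by
    rw [show (η - 2 * b * e) * (η + 2 * b * e) = (η ^ 2 + 4 * e ^ 2) - a * (4 * e ^ 2) by
      rw [hab]; ring]
    exact v.map_sub_lt hηe (by rwa [map_mul, h4, mul_one])
  have hden : v ((1 + b) ^ 2) = 1 := by
    have hb2 : v (2 * b) = 1 := by rw [map_mul, h2, hb, one_mul]
    rw [show (1 + b) ^ 2 = a + 2 * b by rw [hab]; ring,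
      Valuation.map_add_eq_of_lt_right _ (by rwa [hb2]), hb2]
  have hden0 : (1 + b) ≠ 0 := by intro h; simp [h] at hden
  have hae : v (a * e) < 1 := by rwa [map_mul, he, mul_one]
  have haU : v (a * U ^ 2) < 1 := by
    rw [map_mul]
    refine mul_lt_one_of_lt_of_le ha ?_
    rw [show U ^ 2 = (U ^ 2 - η) + η by ring]
    exact v.map_add_le hUη.le hη0.le
  have key : v (η - 2 * b * e) < 1 ∨ v (η + 2 * b * e) < 1 := by
    by_contra! h
    rw [map_mul] at hmul
    exact hmul.not_ge (one_le_mul h.1 h.2)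
  rcases key with h | h
  · refine ⟨U / (1 + b), ?_⟩
    rw [show (U / (1 + b)) ^ 2 - e = ((U ^ 2 - η) + (η - 2 * b * e) - a * e) / (1 + b) ^ 2 by
      field_simp; rw [hab]; ring, map_div₀, hden, div_one]
    exact v.map_sub_lt (v.map_add_lt hUη h) hae
  · refine ⟨b * U / (1 + b), ?_⟩
    rw [show (b * U / (1 + b)) ^ 2 - e =
      (a * U ^ 2 - ((U ^ 2 - η) + (η + 2 * b * e)) - a * e) / (1 + b) ^ 2 by
      field_simp; rw [hab]; ring, map_div₀, hden, div_one]
    exact v.map_sub_lt (v.map_sub_lt haU (v.map_add_lt hUη h)) hae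

/-- Up to a nonzero constant and a square factor, `P` is a norm from `L(√e)(X)`. -/
def Polynomial.IsQuadraticNorm {L : Type*} [Field L] (e : L) (P : Polynomial L) : Prop :=
  ∃ (l : L) (u v w : Polynomial L), l ≠ 0 ∧ w ≠ 0 ∧
    P * w ^ 2 = Polynomial.C l * (u ^ 2 - Polynomial.C e * v ^ 2)

namespace Polynomial.IsQuadraticNorm

variable {L : Type*} [Field L] {e : L} {P Q : Polynomial L}

theorem of_isUnit (h : IsUnit P) : IsQuadraticNorm e P := by
  obtain ⟨l, hl, rfl⟩ := Polynomial.isUnit_iff.mp h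
  exact ⟨l, 1, 0, 1, hl.ne_zero, one_ne_zero, by simp⟩

theorem mul (hP : IsQuadraticNorm e P) (hQ : IsQuadraticNorm e Q) : IsQuadraticNorm e (P * Q) := by
  obtain ⟨l, u, v, w, hl, hw, h⟩ := hP
  obtain ⟨l', u', v', w', hl', hw', h'⟩ := hQ
  refine ⟨l * l', u * u' + C e * v * v', u * v' + v * u', w * w', mul_ne_zero hl hl',
    mul_ne_zero hw hw', ?_⟩
  rw [C_mul]
  linear_combination (C l * (u ^ 2 - C e * v ^ 2)) * h' + Q * w' ^ 2 * h

theorem mul_sq (hP : IsQuadraticNorm e P) (Q : Polynomial L) : IsQuadraticNorm e (Q ^ 2 * P) := by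
  obtain ⟨l, u, v, w, hl, hw, h⟩ := hP
  exact ⟨l, Q * u, Q * v, w, hl, hw, by linear_combination Q ^ 2 * h⟩

theorem of_mul_left (hPQ : IsQuadraticNorm e (P * Q)) (hP : IsQuadraticNorm e P) (hP0 : P ≠ 0) :
    IsQuadraticNorm e Q := by
  obtain ⟨l, u, v, w, hl, hw, h⟩ := hPQ.mul hP
  exact ⟨l, u, v, P * w, hl, mul_ne_zero hP0 hw, by linear_combination h⟩

theorem of_forall_irreducible (hP : P ≠ 0)
    (h : ∀ Q, Irreducible Q → Q ∣ P → IsQuadraticNorm e Q) : IsQuadraticNorm e P := by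
  induction P using WfDvdMonoid.induction_on_irreducible with
  | zero => exact absurd rfl hP
  | unit u hu => exact of_isUnit hu
  | mul a i ha hi ih =>
    exact (h i hi (dvd_mul_right _ _)).mul (ih ha fun Q hQ hQa ↦ h Q hQ (hQa.mul_left _))

theorem of_dvd_sq_sub (he : ¬IsSquare e) {r : Polynomial L} (hQ : Irreducible Q)
    (hr : Q ∣ r ^ 2 - C e) : IsQuadraticNorm e Q := by
  induction hn : Q.natDegree using Nat.strong_induction_on generalizing Q r with
  | _ n ih =>
  have hr' : Q ∣ (r % Q) ^ 2 - C e := by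
    have h1 : Q ∣ r ^ 2 - (r % Q) ^ 2 := by
      rw [sq_sub_sq]
      refine Dvd.dvd.mul_left ?_ _
      exact ⟨r / Q, by linear_combination -EuclideanDomain.div_add_mod r Q⟩
    have := dvd_sub hr h1
    rwa [show r ^ 2 - C e - (r ^ 2 - (r % Q) ^ 2) = (r % Q) ^ 2 - C e by ring] at this
  have hQd : 0 < Q.natDegree := hQ.natDegree_pos
  have hdeg : (r % Q).natDegree < Q.natDegree := natDegree_mod_lt _ hQd.ne'
  generalize r % Q = s at hr' hdeg
  have hs : s ^ 2 - C e ≠ 0 := by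
    intro h
    apply he
    refine ⟨s.eval 0, ?_⟩
    have := congrArg (eval 0) h
    simp only [eval_sub, eval_pow, eval_C, eval_zero] at this
    linear_combination -this
  obtain ⟨G, hG⟩ := hr'
  have hG0 : G ≠ 0 := by rintro rfl; exact hs (by rw [hG, mul_zero])
  have hsd : (s ^ 2 - C e).natDegree ≤ 2 * s.natDegree := by
    refine (natDegree_sub_le _ _).trans ?_
    simp [natDegree_pow]
  have hd : Q.natDegree + G.natDegree = (s ^ 2 - C e).natDegree := by
    rw [hG, natDegree_mul hQ.ne_zero hG0]
  have hGN : IsQuadraticNorm e G := by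
    refine of_forall_irreducible hG0 fun R hR hRG ↦ ?_
    refine ih _ ?_ hR (r := s) ?_ rfl
    · have := natDegree_le_of_dvd hRG hG0
      omega
    · rw [hG]
      exact hRG.mul_left _
  refine of_mul_left (P := G) ?_ hGN hG0
  rw [mul_comm, ← hG]
  exact ⟨1, s, 1, 1, one_ne_zero, one_ne_zero, by simp⟩

theorem exists_eval_eq {w : Polynomial L} {u v : Polynomial L} {l : L} (he : ¬IsSquare e)
    (hl : l ≠ 0) (hw : w ≠ 0) (h : P * w ^ 2 = C l * (u ^ 2 - C e * v ^ 2)) (t : L) :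
    ∃ u₀ v₀, P.eval t = l * (u₀ ^ 2 - e * v₀ ^ 2) := by
  induction hn : w.natDegree using Nat.strong_induction_on generalizing w u v with
  | _ n ih =>
  have ht := congrArg (eval t) h
  simp only [eval_mul, eval_pow, eval_C, eval_sub] at ht
  by_cases hwt : w.eval t = 0
  · have hut : u.eval t ^ 2 = e * v.eval t ^ 2 := by
      rw [hwt] at ht
      have := (mul_eq_zero.mp (ht.symm.trans (by ring))).resolve_left hl
      linear_combination this
    have hvt : v.eval t = 0 := by
      by_contra hv
      exact he ⟨u.eval t / v.eval t, by field_simp; exact hut.symm⟩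
    have hut : u.eval t = 0 := by simpa [hvt] using hut
    obtain ⟨w', rfl⟩ := dvd_iff_isRoot.mpr hwt
    obtain ⟨u', rfl⟩ := dvd_iff_isRoot.mpr hut
    obtain ⟨v', rfl⟩ := dvd_iff_isRoot.mpr hvt
    have hX : (X - C t) ≠ 0 := X_sub_C_ne_zero t
    have hw' : w' ≠ 0 := right_ne_zero_of_mul hw
    refine ih w'.natDegree ?_ hw' (u := u') (v := v') ?_ rfl
    · rw [← hn, natDegree_mul hX hw', natDegree_X_sub_C]
      omega
    · apply mul_left_cancel₀ (pow_ne_zero 2 hX)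
      linear_combination h
  · refine ⟨u.eval t / w.eval t, v.eval t / w.eval t, ?_⟩
    field_simp
    linear_combination ht

theorem exists_eval_eq_of_eval_eq (hP : IsQuadraticNorm e P) (he : ¬IsSquare e) {s t x y : L}
    (hx : x ≠ 0) (hs : P.eval s = x ^ 2) (hy : y ≠ 0) {z : L} (ht : P.eval t = z * y ^ 2) :
    ∃ u v, z = u ^ 2 - e * v ^ 2 := by
  obtain ⟨l, u, v, w, hl, hw, h⟩ := hP
  obtain ⟨u₁, v₁, h₁⟩ := exists_eval_eq he hl hw h s
  obtain ⟨u₂, v₂, h₂⟩ := exists_eval_eq he hl hw h t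
  rw [hs] at h₁
  rw [ht] at h₂
  refine ⟨x * (u₁ * u₂ + e * v₁ * v₂) / ((u₁ ^ 2 - e * v₁ ^ 2) * y),
    x * (u₁ * v₂ + v₁ * u₂) / ((u₁ ^ 2 - e * v₁ ^ 2) * y), ?_⟩
  have hn : u₁ ^ 2 - e * v₁ ^ 2 ≠ 0 := by
    intro h0
    rw [h0, mul_zero] at h₁
    exact hx (pow_eq_zero_iff two_ne_zero |>.mp h₁)
  field_simp
  apply mul_left_cancel₀ hl
  linear_combination l * (u₁ ^ 2 - e * v₁ ^ 2) ^ 2 * h₂ -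
    (u₁ ^ 2 - e * v₁ ^ 2) * l * (u₂ ^ 2 - e * v₂ ^ 2) * h₁

end Polynomial.IsQuadraticNorm

theorem Polynomial.exists_sq_mul_squarefree {L : Type*} [Field L] {P : Polynomial L} (hP : P ≠ 0) :
    ∃ s t : Polynomial L, Squarefree t ∧ P = s ^ 2 * t := by
  induction hn : P.natDegree using Nat.strong_induction_on generalizing P with
  | _ n ih =>
  by_cases h : Squarefree P
  · exact ⟨1, P, h, by ring⟩
  · simp only [Squarefree, not_forall] at h
    obtain ⟨Q, ⟨R, rfl⟩, hQ⟩ := h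
    have hR : R ≠ 0 := right_ne_zero_of_mul hP
    have hQ0 : Q ≠ 0 := left_ne_zero_of_mul (left_ne_zero_of_mul hP)
    have hd : 0 < Q.natDegree := by
      by_contra! h0
      apply hQ
      rw [Polynomial.isUnit_iff_degree_eq_zero, Polynomial.degree_eq_natDegree hQ0]
      simpa using h0
    rw [Polynomial.natDegree_mul (mul_ne_zero hQ0 hQ0) hR, Polynomial.natDegree_mul hQ0 hQ0] at hn
    obtain ⟨s, t, ht, rfl⟩ := ih R.natDegree (by omega) hR rfl
    exact ⟨Q * s, t, ht, by ring⟩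

theorem Polynomial.isQuadraticNorm_mul_of_eq {L K : Type*} [Field L] [Field K]
    [Algebra (Polynomial L) K] [IsFractionRing (Polynomial L) K] {e : L} (he : ¬IsSquare e)
    (h2 : (2 : L) ≠ 0) {a b T U W η : K} (hab : a = b ^ 2 + 1)
    (hη : η ^ 2 + 4 * algebraMap (Polynomial L) K (C e) ^ 2 = a * (b * T) ^ 2)
    (hU : U ^ 2 - a * W ^ 2 = η + a * T) {P D : Polynomial L} (hP : P ≠ 0) (hD : D ≠ 0)
    (hPD : a * algebraMap (Polynomial L) K D = algebraMap (Polynomial L) K P) :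
    IsQuadraticNorm e (P * D) := by
  obtain ⟨s, t, ht, hst⟩ := exists_sq_mul_squarefree (mul_ne_zero hP hD)
  have hs0 : s ≠ 0 := by
    rintro rfl
    rw [zero_pow two_ne_zero, zero_mul] at hst
    exact mul_ne_zero hP hD hst
  rw [hst]
  refine IsQuadraticNorm.mul_sq (IsQuadraticNorm.of_forall_irreducible ht.ne_zero ?_) s
  intro Q hQ hQt
  let q : IsDedekindDomain.HeightOneSpectrum (Polynomial L) :=
    ⟨Ideal.span {Q}, (Ideal.span_singleton_prime hQ.ne_zero).mpr hQ.prime,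
      by simpa using hQ.ne_zero⟩
  have hqmem : ∀ x : Polynomial L, q.valuation K (algebraMap _ K x) < 1 ↔ Q ∣ x := fun x ↦ by
    rw [q.valuation_lt_one_iff_mem, Ideal.mem_span_singleton]
  have hC : ∀ x : L, x ≠ 0 → q.valuation K (algebraMap _ K (C x)) = 1 := by
    intro x hx
    refine le_antisymm (q.valuation_le_one _) ?_
    by_contra! h
    rw [hqmem] at h
    exact hQ.not_isUnit (isUnit_of_dvd_unit h (isUnit_C.mpr hx.isUnit))
  have he0 : e ≠ 0 := by rintro rfl; exact he (IsSquare.zero)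
  have hv : ∀ z, q.valuation K a ≠ q.valuation K z ^ 2 := by
    intro z hz
    obtain ⟨t', rfl⟩ := hQt
    have hQt' : ¬ Q ∣ t' := by
      intro h
      exact hQ.not_isUnit (ht Q (mul_dvd_mul_left Q h))
    have h1 : q.valuation K (algebraMap _ K t') = 1 := by
      refine le_antisymm (q.valuation_le_one _) ?_
      by_contra! h
      exact hQt' ((hqmem _).mp h)
    have hQv : q.valuation K (algebraMap _ K Q) = WithZero.exp (-1 : ℤ) := by
      rw [q.valuation_of_algebraMap, q.intValuation_singleton hQ.ne_zero rfl]
    have hD0 : algebraMap _ K D ≠ 0 := by simpa using hD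
    have hs0' : algebraMap _ K s ≠ 0 := by simpa using hs0
    have key : algebraMap _ K Q * algebraMap _ K t' =
        a * (algebraMap _ K D / algebraMap _ K s) ^ 2 := by
      have := congrArg (algebraMap _ K) hst
      simp only [map_mul, map_pow] at this
      field_simp
      linear_combination -this - algebraMap _ K D * hPD
    have h := congrArg (q.valuation K) key
    rw [map_mul, map_mul, map_pow, h1, mul_one, hQv, hz, ← mul_pow, ← map_mul] at h
    generalize q.valuation K (z * (algebraMap _ K D / algebraMap _ K s)) = w at h
    have hw : w ≠ 0 := by
      rintro rfl
      simp at h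
    have hw' := WithZero.exp_log hw
    rw [← hw', ← WithZero.exp_nsmul, WithZero.exp_inj] at h
    simp at h
    omega
  have hC2 := hC 2 h2
  rw [show (C 2 : Polynomial L) = 2 from rfl, map_ofNat] at hC2
  obtain ⟨z, hz⟩ := (q.valuation K).exists_map_sq_sub_lt_one hC2 (hC e he0) hab hη hU hv
  have hz1 : q.valuation K z ≤ 1 := by
    by_contra! h
    have h' : q.valuation K (algebraMap _ K (C e)) < q.valuation K (z ^ 2) := by
      rw [hC e he0, map_pow]
      exact one_lt_pow₀ h two_ne_zero
    rw [(q.valuation K).map_sub_eq_of_lt_left h', map_pow] at hz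
    exact hz.not_gt (one_lt_pow₀ h two_ne_zero)
  obtain ⟨r, hr⟩ := q.exists_valuation_sub_lt_of_integer hz1 1
  refine IsQuadraticNorm.of_dvd_sq_sub he hQ (r := r) ?_
  rw [← hqmem, map_sub, map_pow]
  have h1 : q.valuation K (algebraMap _ K r + z) ≤ 1 :=
    (q.valuation K).map_add_le (q.valuation_le_one r) hz1
  rw [show algebraMap _ K r ^ 2 - algebraMap _ K (C e) =
    (algebraMap _ K r - z) * (algebraMap _ K r + z) + (z ^ 2 - algebraMap _ K (C e)) by ring]
  refine (q.valuation K).map_add_lt ?_ hz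
  rw [map_mul]
  exact mul_lt_one_of_lt_of_le (by simpa using hr) h1

theorem IsRetractRational.exists_ringHom_fractionRing {k F L K : Type*} [Field k] [Field F]
    [Algebra k F] [Field L] [Algebra k L] [Field K] [Algebra (Polynomial L) K]
    [IsFractionRing (Polynomial L) K] (h : IsRetractRational k F) (j₁ j₂ : F →ₐ[k] L) :
    ∃ Θ : F →+* K,
      (∀ x : k, Θ (algebraMap k F x) =
        algebraMap (Polynomial L) K (Polynomial.C (algebraMap k L x))) ∧
      ∀ x, ∃ P D : Polynomial L, D.eval 0 ≠ 0 ∧ D.eval 1 ≠ 0 ∧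
        Θ x * algebraMap (Polynomial L) K D = algebraMap (Polynomial L) K P ∧
        P.eval 0 = j₁ x * D.eval 0 ∧ P.eval 1 = j₂ x * D.eval 1 := by
  obtain ⟨A, hA, n, f, hf, φ, ψ, hψ⟩ := h
  have hψ' : ∀ x, ψ (φ x) = x := fun x ↦ DFunLike.congr_fun hψ x
  let i₁ : Localization.Away f →ₐ[k] L := (j₁.comp A.val).comp ψ
  let i₂ : Localization.Away f →ₐ[k] L := (j₂.comp A.val).comp ψ
  let ι : MvPolynomial (Fin n) k →ₐ[k] Localization.Away f :=
    IsScalarTower.toAlgHom k _ _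
  let g : MvPolynomial (Fin n) k →ₐ[k] Polynomial L := aeval fun m ↦
    Polynomial.C (i₁ (ι (X m))) * (1 - Polynomial.X) + Polynomial.C (i₂ (ι (X m))) * Polynomial.X
  have hg₁ : ∀ p, (g p).eval 0 = i₁ (ι p) := by
    have : ((Polynomial.aeval (0 : L)).restrictScalars k).comp g = i₁.comp ι := by
      ext m
      simp [g]
    intro p
    simpa [Polynomial.aeval_def] using DFunLike.congr_fun this p
  have hg₂ : ∀ p, (g p).eval 1 = i₂ (ι p) := by
    have : ((Polynomial.aeval (1 : L)).restrictScalars k).comp g = i₂.comp ι := by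
      ext m
      simp [g]
    intro p
    simpa [Polynomial.aeval_def] using DFunLike.congr_fun this p
  have hu : IsUnit (ι f) := IsLocalization.Away.algebraMap_isUnit f
  have hgf₁ : (g f).eval 0 ≠ 0 := by
    rw [hg₁]
    exact (hu.map i₁).ne_zero
  have hgf₂ : (g f).eval 1 ≠ 0 := by
    rw [hg₂]
    exact (hu.map i₂).ne_zero
  have hgf : g f ≠ 0 := by
    intro h0
    simp [h0] at hgf₁
  have hunit : IsUnit (((algebraMap (Polynomial L) K).comp g.toRingHom) f) := by
    simpa using hgf
  let G : Localization.Away f →+* K := IsLocalization.Away.lift f hunit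
  have hG : ∀ p, G (ι p) = algebraMap (Polynomial L) K (g p) := fun p ↦
    IsLocalization.Away.lift_eq f hunit p
  have hGPD : ∀ y, ∃ P D : Polynomial L, D.eval 0 ≠ 0 ∧ D.eval 1 ≠ 0 ∧
      G y * algebraMap (Polynomial L) K D = algebraMap (Polynomial L) K P ∧
      P.eval 0 = i₁ y * D.eval 0 ∧ P.eval 1 = i₂ y * D.eval 1 := by
    intro y
    obtain ⟨m, p, hp⟩ := IsLocalization.Away.surj f y
    change y * ι f ^ m = ι p at hp
    rw [← map_pow] at hp
    refine ⟨g p, g (f ^ m), ?_, ?_, ?_, ?_, ?_⟩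
    · rw [map_pow, Polynomial.eval_pow]
      exact pow_ne_zero _ hgf₁
    · rw [map_pow, Polynomial.eval_pow]
      exact pow_ne_zero _ hgf₂
    · rw [← hG, ← hG, ← map_mul, hp]
    · rw [hg₁, hg₁, ← map_mul, hp]
    · rw [hg₂, hg₂, ← map_mul, hp]
  have hinj : Function.Injective (G.comp φ.toRingHom) := by
    rw [injective_iff_map_eq_zero]
    intro x hx
    obtain ⟨P, D, hD, -, hPD, hP, -⟩ := hGPD (φ x)
    change G (φ x) = 0 at hx
    rw [hx, zero_mul, eq_comm, FaithfulSMul.algebraMap_eq_zero_iff] at hPD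
    rw [hPD, Polynomial.eval_zero, eq_comm, mul_eq_zero, or_iff_left hD] at hP
    simpa [i₁, hψ'] using hP
  refine ⟨IsFractionRing.lift hinj, ?_, ?_⟩
  · intro x
    have h1 : algebraMap k F x = algebraMap A F (algebraMap k A x) := rfl
    rw [h1, IsFractionRing.lift_algebraMap]
    change G (φ (algebraMap k A x)) = _
    rw [AlgHom.commutes, ← ι.commutes, hG, AlgHom.commutes]
    rfl
  · intro x
    obtain ⟨p, q, hq, rfl⟩ := IsFractionRing.div_surjective (A := A) x
    have hq0 : (q : F) ≠ 0 := by simpa using nonZeroDivisors.ne_zero hq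
    obtain ⟨P, D, hD₁, hD₂, hPD, hP₁, hP₂⟩ := hGPD (φ p)
    obtain ⟨P', D', hD₁', hD₂', hPD', hP₁', hP₂'⟩ := hGPD (φ q)
    have hi₁ : ∀ x : A, i₁ (φ x) = j₁ x := fun x ↦ by simp [i₁, hψ']
    have hi₂ : ∀ x : A, i₂ (φ x) = j₂ x := fun x ↦ by simp [i₂, hψ']
    rw [hi₁] at hP₁ hP₁'
    rw [hi₂] at hP₂ hP₂'
    have hj₁ : j₁ q ≠ 0 := by simpa using hq0
    have hj₂ : j₂ q ≠ 0 := by simpa using hq0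
    have hGq : G (φ q) ≠ 0 := by
      intro h0
      apply nonZeroDivisors.ne_zero hq
      exact (injective_iff_map_eq_zero _).mp hinj q h0
    refine ⟨P * D', D * P', ?_, ?_, ?_, ?_, ?_⟩
    · rw [Polynomial.eval_mul, hP₁']
      exact mul_ne_zero hD₁ (mul_ne_zero hj₁ hD₁')
    · rw [Polynomial.eval_mul, hP₂']
      exact mul_ne_zero hD₂ (mul_ne_zero hj₂ hD₂')
    · rw [map_div₀, IsFractionRing.lift_algebraMap, IsFractionRing.lift_algebraMap]
      change G (φ p) / G (φ q) * _ = _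
      rw [map_mul, map_mul, ← hPD, ← hPD']
      field_simp
    · change _ = j₁ ((p : F) / q) * _
      rw [Polynomial.eval_mul, Polynomial.eval_mul, hP₁, hP₁', map_div₀]
      field_simp
    · change _ = j₂ ((p : F) / q) * _
      rw [Polynomial.eval_mul, Polynomial.eval_mul, hP₂, hP₂', map_div₀]
      field_simp

theorem IsRetractRational.exists_map_eq_sq_sub {k F L : Type*} [Field k] [Field F]
    [Algebra k F] [Field L] [Algebra k L] (h : IsRetractRational k F) (j₁ j₂ : F →ₐ[k] L)
    {c : k} {e : L} (he : ¬IsSquare e) (h2 : (2 : L) ≠ 0) (hc : algebraMap k L c = -4 * e ^ 2)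
    {a b T U W η : F} (hab : a = b ^ 2 + 1) (hη : η ^ 2 - algebraMap k F c = a * (b * T) ^ 2)
    (hU : U ^ 2 - a * W ^ 2 = η + a * T) {β : L} (hβ : β ≠ 0) (hjβ : j₁ a = β ^ 2) :
    ∃ u v, j₂ a = u ^ 2 - e * v ^ 2 := by
  obtain ⟨Θ, hΘ, hΘPD⟩ := h.exists_ringHom_fractionRing (K := FractionRing (Polynomial L)) j₁ j₂
  obtain ⟨P, D, hD₁, hD₂, hPD, hP₁, hP₂⟩ := hΘPD a
  have hD : D ≠ 0 := by rintro rfl; simp at hD₁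
  have hP : P ≠ 0 := by
    rintro rfl
    rw [Polynomial.eval_zero, eq_comm, mul_eq_zero, or_iff_left hD₁, hjβ] at hP₁
    exact hβ (pow_eq_zero_iff two_ne_zero |>.mp hP₁)
  have hN := Polynomial.isQuadraticNorm_mul_of_eq (K := FractionRing (Polynomial L)) he h2
    (a := Θ a) (b := Θ b) (T := Θ T) (U := Θ U) (W := Θ W) (η := Θ η)
    (by rw [hab]; simp) ?_ (by simpa using congrArg Θ hU) hP hD hPD
  · refine hN.exists_eval_eq_of_eval_eq he (s := 0) (t := 1) (x := β * D.eval 0) (y := D.eval 1)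
      (mul_ne_zero hβ hD₁) ?_ hD₂ ?_
    · rw [Polynomial.eval_mul, hP₁, hjβ]
      ring
    · rw [Polynomial.eval_mul, hP₂]
      ring
  · have h1 := congrArg Θ hη
    rw [map_sub, hΘ, hc] at h1
    simp only [map_mul, map_pow, map_neg, show (Polynomial.C 4 : Polynomial L) = 4 from rfl,
      map_ofNat] at h1
    linear_combination h1

namespace IsMonomialC4

variable {k M : Type*} [Field k] [Field M] [Algebra k M] {c : k} {σ : M ≃ₐ[k] M} {x₁ x₂ x₃ x₄ : M}

theorem exists_relations (h : IsMonomialC4 c σ x₁ x₂ x₃ x₄) (hc : c ≠ 0) (hk : ringChar k ≠ 2) :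
    ∃ a b T U W η s : M, (σ a = a ∧ σ b = b ∧ σ T = T ∧ σ U = U ∧ σ W = W ∧ σ η = η) ∧
      σ s = -s ∧ s ≠ 0 ∧ a = s ^ 2 ∧ a = b ^ 2 + 1 ∧
      η ^ 2 - algebraMap k M c = a * (b * T) ^ 2 ∧ U ^ 2 - a * W ^ 2 = η + a * T := by
  have h2 := h.ne_zero_of_ringChar hk
  obtain ⟨A, hA⟩ : ∃ A, A = x₁ + x₃ := ⟨_, rfl⟩
  obtain ⟨B, hB⟩ : ∃ B, B = x₁ - x₃ := ⟨_, rfl⟩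
  obtain ⟨A', hA'⟩ : ∃ A', A' = x₂ + x₄ := ⟨_, rfl⟩
  obtain ⟨B', hB'⟩ : ∃ B', B' = x₂ - x₄ := ⟨_, rfl⟩
  have hA0 : A ≠ 0 := by
    refine h.ne_zero_of_eval (X 0 + X 2) ![1, 0, 0] (by simp) fun h0 ↦ ?_
    rw [← h0, hA]
    simp
  have hB0 : B ≠ 0 := by
    refine h.ne_zero_of_eval (X 0 - X 2) ![1, 0, 0] (by simp) fun h0 ↦ ?_
    rw [← h0, hB]
    simp
  have hσA : σ A = A' := by rw [hA, hA', map_add, h.map₁, h.map₃]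
  have hσB : σ B = B' := by rw [hB, hB', map_sub, h.map₁, h.map₃]
  have hσA' : σ A' = A := by rw [hA, hA', map_add, h.map₂, h.map₄, add_comm]
  have hσB' : σ B' = -B := by rw [hB, hB', map_sub, h.map₂, h.map₄, neg_sub]
  have hA0' : A' ≠ 0 := by rw [← hσA]; simpa using hA0
  have hB0' : B' ≠ 0 := by rw [← hσB]; simpa using hB0
  have hc16 : 16 * algebraMap k M c = (A ^ 2 - B ^ 2) * (A' ^ 2 - B' ^ 2) := by
    rw [← h.prod, hA, hB, hA', hB']
    ring
  have hy0 : A ^ 2 * B' ^ 2 + A' ^ 2 * B ^ 2 ≠ 0 := by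
    have h2k : (2 : k) ≠ 0 := by
      intro h0
      have := congrArg (algebraMap k M) h0
      rw [map_ofNat, map_zero] at this
      exact h2 this
    refine h.ne_zero_of_eval ((X 0 + X 2) ^ 2 * (X 0 * X 1 ^ 2 * X 2 - C c) ^ 2 +
      (X 0 * X 1 ^ 2 * X 2 + C c) ^ 2 * (X 0 - X 2) ^ 2) ![1, 0, 0] ?_ fun h0 ↦ ?_
    · simp [← two_mul, h2k, hc]
    · have h1 := congrArg (· * (x₁ * x₂ * x₃) ^ 2) h0
      simp only [zero_mul] at h1
      rw [← h1, hA, hB, hA', hB']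
      simp [← h.prod]
      ring
  have hy : (A / B) ^ 2 + (A' / B') ^ 2 ≠ 0 := by
    intro h0
    apply hy0
    field_simp at h0
    linear_combination h0
  obtain ⟨m, hm⟩ : ∃ m, m = A / B := ⟨_, rfl⟩
  obtain ⟨m', hm'⟩ : ∃ m', m' = A' / B' := ⟨_, rfl⟩
  rw [← hm, ← hm'] at hy
  have hm0 : m ≠ 0 := by rw [hm]; positivity
  have hm0' : m' ≠ 0 := by rw [hm']; positivity
  have hσm : σ m = m' := by rw [hm, hm', map_div₀, hσA, hσB]
  have hσm' : σ m' = -m := by rw [hm, hm', map_div₀, hσA', hσB', div_neg]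
  have hc16' : 16 * algebraMap k M c = B ^ 2 * B' ^ 2 * (m ^ 2 - 1) * (m' ^ 2 - 1) := by
    rw [hc16, hm, hm']
    field_simp
  clear hc16 hy0 hm hm' hσA hσA' hA hA' hB hB'
  obtain ⟨y, hyd⟩ : ∃ y, y = m ^ 2 + m' ^ 2 := ⟨_, rfl⟩
  rw [← hyd] at hy
  have hσy : σ y = y := by
    rw [hyd, map_add, map_pow, map_pow, hσm, hσm']
    ring
  obtain ⟨b, hb⟩ : ∃ b, b = (m' ^ 2 - m ^ 2) / (2 * m * m') := ⟨_, rfl⟩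
  obtain ⟨s, hs⟩ : ∃ s, s = y / (2 * m * m') := ⟨_, rfl⟩
  obtain ⟨T, hT⟩ : ∃ T, T = m * m' * B * B' / (2 * y) := ⟨_, rfl⟩
  obtain ⟨D, hD⟩ : ∃ D, D = m' ^ 2 * B / (2 * m) := ⟨_, rfl⟩
  obtain ⟨D', hD'⟩ : ∃ D', D' = m ^ 2 * B' / (2 * m') := ⟨_, rfl⟩
  have hs0 : s ≠ 0 := by rw [hs]; positivity
  have hσs : σ s = -s := by
    rw [hs]
    simp only [map_div₀, map_mul, map_ofNat, hσm, hσm', hσy]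
    field_simp
  have hσb : σ b = b := by
    rw [hb]
    simp only [map_div₀, map_mul, map_sub, map_pow, map_ofNat, hσm, hσm']
    field_simp
    ring
  have hσT : σ T = T := by
    rw [hT]
    simp only [map_div₀, map_mul, map_ofNat, hσm, hσm', hσy, hσB, hσB']
    ring
  have hσD : σ D = D' := by
    rw [hD, hD']
    simp only [map_div₀, map_mul, map_pow, map_ofNat, hσm, hσm', hσB]
    ring
  have hσD' : σ D' = D := by
    rw [hD, hD']
    simp only [map_div₀, map_mul, map_pow, map_ofNat, hσm, hσm', hσB']
    field_simp
  refine ⟨s ^ 2, b, T, (D + D') / 2, (D - D') / (2 * s), T * (y / 2 - s ^ 2), s, ⟨?_, hσb, hσT,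
    ?_, ?_, ?_⟩, hσs, hs0, rfl, ?_, ?_, ?_⟩
  · rw [map_pow, hσs, neg_sq]
  · rw [map_div₀, map_add, hσD, hσD', map_ofNat, add_comm]
  · rw [map_div₀, map_sub, hσD, hσD', map_mul, hσs, map_ofNat]
    field_simp
    ring
  · rw [map_mul, hσT, map_sub, map_pow, hσs, map_div₀, hσy, map_ofNat, neg_sq]
  · rw [hs, hb, hyd]
    field_simp
    ring
  · have : (16 : M) ≠ 0 := by
      rw [show (16 : M) = 2 ^ 4 by norm_num]
      exact pow_ne_zero _ h2
    apply mul_left_cancel₀ this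
    rw [mul_sub, hc16', hs, hb, hT]
    field_simp
    rw [hyd]
    ring
  · rw [hs, hT, hD, hD']
    field_simp
    ring

end IsMonomialC4

namespace AlgebraicIndependent

variable {ι k M E : Type*} [Field k] [Field M] [Algebra k M] [Field E] [Algebra k E]

theorem exists_algHom_eq {u : ι → M} (hu : AlgebraicIndependent k u)
    (hgen : IntermediateField.adjoin k (Set.range u) = ⊤) {y : ι → E}
    (hy : AlgebraicIndependent k y) : ∃ J : M →ₐ[k] E, ∀ i, J (u i) = y i := by
  let f : IntermediateField.adjoin k (Set.range u) →ₐ[k] E :=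
    (IntermediateField.val _).comp (hu.aevalEquivField.symm.trans hy.aevalEquivField).toAlgHom
  let g : M →ₐ[k] IntermediateField.adjoin k (Set.range u) :=
    ((IntermediateField.equivOfEq hgen).trans IntermediateField.topEquiv).symm.toAlgHom
  refine ⟨f.comp g, fun i ↦ ?_⟩
  have hg : g (u i) = hu.aevalEquivField (algebraMap (MvPolynomial ι k) _ (X i)) := by
    apply Subtype.ext
    rw [hu.aevalEquivField_algebraMap_apply_coe, aeval_X]
    rfl
  rw [AlgHom.comp_apply, hg]
  simp [f]

theorem exists_algEquiv_eq {u : ι → M} (hu : AlgebraicIndependent k u)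
    (hgen : IntermediateField.adjoin k (Set.range u) = ⊤) {y : ι → E}
    (hy : AlgebraicIndependent k y) (hygen : IntermediateField.adjoin k (Set.range y) = ⊤) :
    ∃ J : M ≃ₐ[k] E, ∀ i, J (u i) = y i := by
  obtain ⟨J, hJ⟩ := hu.exists_algHom_eq hgen hy
  refine ⟨AlgEquiv.ofBijective J ⟨J.injective, ?_⟩, hJ⟩
  rw [← AlgHom.fieldRange_eq_top, eq_top_iff, ← hygen, IntermediateField.adjoin_le_iff]
  rintro _ ⟨i, rfl⟩
  exact ⟨u i, hJ i⟩

end AlgebraicIndependent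

namespace IsMonomialC4

variable {k M : Type*} [Field k] [Field M] [Algebra k M] {c : k} {x₁ x₂ x₃ : M}

theorem of_map (hc : c ≠ 0) (hi : AlgebraicIndependent k ![x₁, x₂, x₃])
    (hg : IntermediateField.adjoin k (Set.range ![x₁, x₂, x₃]) = ⊤) {σ : M ≃ₐ[k] M}
    (h₁ : σ x₁ = x₂) (h₂ : σ x₂ = x₃) (h₃ : σ x₃ = algebraMap k M c * (x₁ * x₂ * x₃)⁻¹) :
    IsMonomialC4 c σ x₁ x₂ x₃ (algebraMap k M c * (x₁ * x₂ * x₃)⁻¹) := by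
  have hc' : algebraMap k M c ≠ 0 := by simpa using hc
  have hx₁ : x₁ ≠ 0 := hi.ne_zero 0
  have hx₂ : x₂ ≠ 0 := hi.ne_zero 1
  have hx₃ : x₃ ≠ 0 := hi.ne_zero 2
  refine ⟨hi, hg, h₁, h₂, h₃, ?_, ?_⟩
  · rw [map_mul, map_inv₀, map_mul, map_mul, h₁, h₂, h₃, AlgEquiv.commutes]
    field_simp
  · field_simp

theorem exists_algEquiv (hc : c ≠ 0) (hi : AlgebraicIndependent k ![x₁, x₂, x₃])
    (hg : IntermediateField.adjoin k (Set.range ![x₁, x₂, x₃]) = ⊤) :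
    ∃ σ : M ≃ₐ[k] M, IsMonomialC4 c σ x₁ x₂ x₃ (algebraMap k M c * (x₁ * x₂ * x₃)⁻¹) := by
  have hc' : algebraMap k M c ≠ 0 := by simpa using hc
  have hx₁ : x₁ ≠ 0 := hi.ne_zero 0
  have hx₂ : x₂ ≠ 0 := hi.ne_zero 1
  have hx₃ : x₃ ≠ 0 := hi.ne_zero 2
  obtain ⟨x₄, hx₄⟩ : ∃ x₄, x₄ = algebraMap k M c * (x₁ * x₂ * x₃)⁻¹ := ⟨_, rfl⟩
  have hg' : IntermediateField.adjoin k (Set.range ![x₂, x₃, x₄]) = ⊤ := by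
    have h₂ : x₂ ∈ IntermediateField.adjoin k (Set.range ![x₂, x₃, x₄]) :=
      IntermediateField.subset_adjoin _ _ ⟨0, rfl⟩
    have h₃ : x₃ ∈ IntermediateField.adjoin k (Set.range ![x₂, x₃, x₄]) :=
      IntermediateField.subset_adjoin _ _ ⟨1, rfl⟩
    have h₄ : x₄ ∈ IntermediateField.adjoin k (Set.range ![x₂, x₃, x₄]) :=
      IntermediateField.subset_adjoin _ _ ⟨2, rfl⟩
    rw [eq_top_iff, ← hg, IntermediateField.adjoin_le_iff]
    rintro _ ⟨i, rfl⟩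
    fin_cases i
    · have : x₁ = algebraMap k M c / (x₂ * x₃ * x₄) := by
        rw [hx₄]
        field_simp
      change x₁ ∈ _
      rw [this]
      exact div_mem (IntermediateField.algebraMap_mem _ c) (mul_mem (mul_mem h₂ h₃) h₄)
    · exact h₂
    · exact h₃
  have hi' : AlgebraicIndependent k ![x₂, x₃, x₄] := by
    have : Algebra.IsAlgebraic (IntermediateField.adjoin k (Set.range ![x₂, x₃, x₄])) M := by
      rw [hg', Algebra.isAlgebraic_iff_isIntegral]
      exact Algebra.isIntegral_of_surjective IntermediateField.topEquiv.surjective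
    exact algebraicIndependent_of_isAlgebraic_adjoin (trdeg_eq_three_of_indep hi hg)
  obtain ⟨σ, hσ⟩ := hi.exists_algEquiv_eq hg hi' hg'
  exact ⟨σ, of_map hc hi hg (hσ 0) (hσ 1) ((hσ 2).trans hx₄)⟩

end IsMonomialC4

namespace MvPolynomial

variable (k : Type*) [Field k]

theorem algebraicIndependent_algebraMap_X : AlgebraicIndependent k
    ![algebraMap (MvPolynomial (Fin 3) k) (FractionRing (MvPolynomial (Fin 3) k)) (X 0),
      algebraMap (MvPolynomial (Fin 3) k) (FractionRing (MvPolynomial (Fin 3) k)) (X 1),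
      algebraMap (MvPolynomial (Fin 3) k) (FractionRing (MvPolynomial (Fin 3) k)) (X 2)] := by
  have h := (algebraicIndependent_X (Fin 3) k).map'
    (f := IsScalarTower.toAlgHom k _ (FractionRing (MvPolynomial (Fin 3) k)))
    (IsFractionRing.injective _ _)
  convert h using 1
  ext i
  fin_cases i <;> rfl

theorem adjoin_algebraMap_X : IntermediateField.adjoin k (Set.range
    ![algebraMap (MvPolynomial (Fin 3) k) (FractionRing (MvPolynomial (Fin 3) k)) (X 0),
      algebraMap (MvPolynomial (Fin 3) k) (FractionRing (MvPolynomial (Fin 3) k)) (X 1),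
      algebraMap (MvPolynomial (Fin 3) k) (FractionRing (MvPolynomial (Fin 3) k)) (X 2)]) = ⊤ := by
  rw [eq_top_iff]
  have h : ∀ p, algebraMap (MvPolynomial (Fin 3) k) (FractionRing (MvPolynomial (Fin 3) k)) p ∈
      IntermediateField.adjoin k (Set.range ![algebraMap (MvPolynomial (Fin 3) k)
        (FractionRing (MvPolynomial (Fin 3) k)) (X 0), algebraMap (MvPolynomial (Fin 3) k)
        (FractionRing (MvPolynomial (Fin 3) k)) (X 1), algebraMap (MvPolynomial (Fin 3) k)
        (FractionRing (MvPolynomial (Fin 3) k)) (X 2)]) := by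
    intro p
    induction p using MvPolynomial.induction_on with
    | C a => exact IntermediateField.algebraMap_mem _ a
    | add p q hp hq => rw [map_add]; exact add_mem hp hq
    | mul_X p i hp =>
      rw [map_mul]
      refine mul_mem hp (IntermediateField.subset_adjoin _ _ ⟨i, ?_⟩)
      fin_cases i <;> rfl
  intro x _
  obtain ⟨p, q, -, rfl⟩ := IsFractionRing.div_surjective (A := MvPolynomial (Fin 3) k) x
  exact div_mem (h p) (h q)

end MvPolynomial

namespace IsMonomialC4

variable {k k' M M' : Type*} [Field k] [Field k'] [Algebra k k'] [Field M] [Algebra k M]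
  [Field M'] [Algebra k' M'] [Algebra k M'] [IsScalarTower k k' M'] {c : k} {σ : M ≃ₐ[k] M}
  {σ' : M' ≃ₐ[k'] M'} {x₁ x₂ x₃ x₄ : M} {x₁' x₂' x₃' x₄' : M'}

theorem exists_algebraicIndependent_fixedField (h : IsMonomialC4 c σ x₁ x₂ x₃ x₄) :
    ∃ y : Fin 3 → IntermediateField.fixedField (Subgroup.zpowers σ), AlgebraicIndependent k y := by
  have := h.finite_fixedField
  have htr := trdeg_add_eq k (IntermediateField.fixedField (Subgroup.zpowers σ)) (A := M)
  rw [h.trdeg_eq, trdeg_eq_zero (R := IntermediateField.fixedField (Subgroup.zpowers σ)), add_zero] at htr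
  obtain ⟨s, hs⟩ := exists_isTranscendenceBasis k (IntermediateField.fixedField (Subgroup.zpowers σ))
  have hcard := hs.cardinalMk_eq_trdeg
  rw [htr] at hcard
  have : Nonempty (Fin 3 ≃ s) := by
    have : Cardinal.mk s = ((3 : ℕ) : Cardinal) := by simpa using hcard
    have := Cardinal.mk_eq_nat_iff.mp this
    exact this.map Equiv.symm
  obtain ⟨f⟩ := this
  exact ⟨_, hs.1.comp f f.injective⟩

theorem not_isRetractRational (h : IsMonomialC4 c σ x₁ x₂ x₃ x₄)
    (h' : IsMonomialC4 (algebraMap k k' c) σ' x₁' x₂' x₃' x₄') {e : k'}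
    (hce : algebraMap k k' c = -4 * e ^ 2) (he : ¬IsSquare e) (he' : ¬IsSquare (-e))
    (h1 : ¬IsSquare (-1 : k')) (hc : c ≠ 0) (hk : ringChar k ≠ 2) :
    ¬IsRetractRational k (IntermediateField.fixedField (Subgroup.zpowers σ)) := by
  intro hr
  have h2k : (2 : k) ≠ 0 := Ring.two_ne_zero hk
  have h2 : (2 : k') ≠ 0 := by
    rw [← map_ofNat (algebraMap k k') 2]
    simpa using h2k
  have h2M : (2 : M') ≠ 0 := by
    rw [← map_ofNat (algebraMap k' M') 2]
    simpa using h2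
  have hrest : ∀ τ : M →ₐ[k] M', (∀ x, σ x = x → σ' (τ x) = τ x) →
      ∃ j : IntermediateField.fixedField (Subgroup.zpowers σ) →ₐ[k]
        IntermediateField.fixedField (Subgroup.zpowers σ'), ∀ x, (j x : M') = τ x := by
    intro τ hτ
    have hτ' : ∀ x : IntermediateField.fixedField (Subgroup.zpowers σ),
        τ x ∈ IntermediateField.fixedField (Subgroup.zpowers σ') := fun x ↦
      (mem_fixedField _).mpr (hτ _ ((mem_fixedField _).mp x.2))
    exact ⟨{
      toFun := fun x ↦ ⟨τ x, hτ' x⟩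
      map_one' := Subtype.ext (map_one τ)
      map_mul' := fun x y ↦ Subtype.ext (map_mul τ (x : M) y)
      map_zero' := Subtype.ext (map_zero τ)
      map_add' := fun x y ↦ Subtype.ext (map_add τ (x : M) y)
      commutes' := fun r ↦ Subtype.ext ((τ.commutes r).trans rfl) }, fun x ↦ rfl⟩
  obtain ⟨τ, hτ⟩ := h.indep.exists_algHom_eq h.gen
    (h'.indep.restrictScalars (algebraMap k k').injective)
  have hτ₁ : τ x₁ = x₁' := hτ 0
  have hτ₂ : τ x₂ = x₂' := hτ 1
  have hτ₃ : τ x₃ = x₃' := hτ 2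
  have hτ₄ : τ x₄ = x₄' := by
    rw [h.x₄_eq, h'.x₄_eq, ← IsScalarTower.algebraMap_apply]
    simp [hτ₁, hτ₂, hτ₃]
  have hτσ : ∀ x, τ (σ x) = σ' (τ x) := by
    have : τ.comp (σ : M →ₐ[k] M) = ((σ' : M' →ₐ[k'] M').restrictScalars k).comp τ := by
      apply h.algHom_ext <;>
        simp [h.map₁, h.map₂, h.map₃, h'.map₁, h'.map₂, h'.map₃, hτ₁, hτ₂, hτ₃, hτ₄]
    exact fun x ↦ DFunLike.congr_fun this x
  obtain ⟨y, hy⟩ := h'.exists_algebraicIndependent_fixedField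
  obtain ⟨ρ, -⟩ := h.indep.exists_algHom_eq h.gen
    (hy.restrictScalars (algebraMap k k').injective)
  obtain ⟨j₂, hj₂⟩ := hrest τ (fun x hx ↦ by rw [← hτσ, hx])
  let j₁ := ρ.comp (IntermediateField.val (IntermediateField.fixedField (Subgroup.zpowers σ))
    |>.restrictScalars k)
  obtain ⟨a, b, T, U, W, η, s, ⟨ha, hb, hT, hU, hW, hη⟩, hσs, hs0, has, hab, hηc, hUW⟩ :=
    h.exists_relations hc hk
  rw [← mem_fixedField] at ha hb hT hU hW hη
  have heL : ¬IsSquare (algebraMap k' (IntermediateField.fixedField (Subgroup.zpowers σ')) e) := by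
    rintro ⟨w, hw⟩
    refine h'.mul_map_ne hce he he' h1 h2 (w : M') ?_
    rw [(mem_fixedField _).mp w.2]
    exact congrArg Subtype.val hw.symm
  obtain ⟨u, v, huv⟩ := hr.exists_map_eq_sq_sub j₁ j₂ (c := c) heL
    (a := ⟨a, ha⟩) (b := ⟨b, hb⟩) (T := ⟨T, hT⟩) (U := ⟨U, hU⟩) (W := ⟨W, hW⟩) (η := ⟨η, hη⟩)
    (fun h0 ↦ h2M (congrArg Subtype.val h0))
    (by rw [IsScalarTower.algebraMap_apply k k', hce, map_mul, map_neg, map_pow, map_ofNat])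
    (Subtype.ext hab) (Subtype.ext hηc) (Subtype.ext hUW) (β := ρ s) (by simpa using hs0)
    (by rw [← map_pow, ← has]; rfl)
  have huv' : τ s ^ 2 = (u : M') ^ 2 - algebraMap k' M' e * (v : M') ^ 2 := by
    rw [← map_pow, ← has]
    exact (hj₂ _).symm.trans (congrArg Subtype.val huv)
  have hσu := (mem_fixedField _).mp u.2
  have hσv := (mem_fixedField _).mp v.2
  have hσs' : σ' (τ s) = -τ s := by rw [← hτσ, hσs, map_neg]
  have hs0' : τ s ≠ 0 := by simpa using hs0
  generalize (u : M') = u at *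
  generalize (v : M') = v at *
  generalize τ s = s at *
  by_cases hv : v = 0
  · have hsu : s = u ∨ s = -u := by
      apply sq_eq_sq_iff_eq_or_eq_neg.mp
      rw [huv', hv]
      ring
    have : σ' s = s := by
      rcases hsu with h | h <;> simp [h, hσu]
    rw [hσs'] at this
    have h0 : 2 * s = 0 := by linear_combination -this
    exact mul_ne_zero h2M hs0' h0
  · refine h'.mul_map_ne hce he he' h1 h2 ((u + s) / v) ?_
    rw [map_div₀, map_add, hσu, hσs', hσv]
    field_simp
    linear_combination -huv'

end IsMonomialC4

theorem exists_quadratic_extension {k : Type*} [Field k] {d : k} (hd : ¬IsSquare d) :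
    ∃ p : Polynomial k, ∃ _ : Fact (Irreducible p), ∃ s : AdjoinRoot p,
      s ^ 2 = algebraMap k _ d ∧ ∀ z : AdjoinRoot p, ∃ a b : k,
        z = algebraMap k _ a + algebraMap k _ b * s := by
  have hdeg : (Polynomial.X ^ 2 - Polynomial.C d).natDegree = 2 := by compute_degree!
  have hm : (Polynomial.X ^ 2 - Polynomial.C d).Monic := Polynomial.monic_X_pow_sub_C d two_ne_zero
  have hirr : Irreducible (Polynomial.X ^ 2 - Polynomial.C d) := by
    apply Polynomial.irreducible_of_degree_le_three_of_not_isRoot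
    · rw [hdeg]; decide
    · intro x hx
      apply hd
      refine ⟨x, ?_⟩
      simp only [Polynomial.IsRoot.def, Polynomial.eval_sub, Polynomial.eval_pow,
        Polynomial.eval_X, Polynomial.eval_C] at hx
      linear_combination -hx
  refine ⟨_, ⟨hirr⟩, AdjoinRoot.root _, ?_, ?_⟩
  · have h := AdjoinRoot.eval₂_root (Polynomial.X ^ 2 - Polynomial.C d)
    simp only [Polynomial.eval₂_sub, Polynomial.eval₂_pow, Polynomial.eval₂_X,
      Polynomial.eval₂_C] at h
    exact sub_eq_zero.mp h
  · intro z
    obtain ⟨g, rfl⟩ := AdjoinRoot.mk_surjective z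
    have hg : (g %ₘ (Polynomial.X ^ 2 - Polynomial.C d)).natDegree ≤ 1 := by
      have := Polynomial.natDegree_modByMonic_lt g hm (by
        intro h1
        rw [h1] at hdeg
        simp at hdeg)
      omega
    obtain ⟨b, a, hab⟩ := Polynomial.exists_eq_X_add_C_of_natDegree_le_one hg
    refine ⟨a, b, ?_⟩
    have h1 : AdjoinRoot.mk (Polynomial.X ^ 2 - Polynomial.C d) g =
        AdjoinRoot.mk (Polynomial.X ^ 2 - Polynomial.C d)
          (g %ₘ (Polynomial.X ^ 2 - Polynomial.C d)) := by
      rw [AdjoinRoot.mk_eq_mk]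
      refine ⟨g /ₘ (Polynomial.X ^ 2 - Polynomial.C d), ?_⟩
      linear_combination -Polynomial.modByMonic_add_div g (Polynomial.X ^ 2 - Polynomial.C d)
    rw [h1, hab, map_add, map_mul, AdjoinRoot.mk_X, AdjoinRoot.mk_C, AdjoinRoot.mk_C, add_comm]
    rfl

theorem exists_extension_not_isSquare.{u} {k : Type u} [Field k] {c : k} (h2 : (2 : k) ≠ 0)
    (hc : ∀ d : k, d ^ 2 ≠ c) (hc4 : ∀ d : k, d ^ 4 ≠ -4 * c) (hi : ∀ d : k, d ^ 2 ≠ -1) :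
    ∃ (k' : Type u) (_ : Field k') (_ : Algebra k k') (e : k'),
      algebraMap k k' c = -4 * e ^ 2 ∧ ¬IsSquare e ∧ ¬IsSquare (-e) ∧ ¬IsSquare (-1 : k') := by
  by_cases hd : IsSquare (-c)
  · obtain ⟨s, hs⟩ := hd
    refine ⟨k, inferInstance, inferInstance, s / 2, ?_, ?_, ?_, ?_⟩
    · rw [Algebra.algebraMap_self_apply]
      field_simp
      linear_combination -4 * hs
    · rintro ⟨μ, hμ⟩
      apply hc4 (2 * μ)
      have : s = 2 * μ ^ 2 := by
        field_simp at hμ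
        linear_combination hμ
      rw [this] at hs
      linear_combination -4 * hs
    · rintro ⟨μ, hμ⟩
      apply hc4 (2 * μ)
      have : s = -(2 * μ ^ 2) := by
        field_simp at hμ
        linear_combination -hμ
      rw [this] at hs
      linear_combination -4 * hs
    · rintro ⟨μ, hμ⟩
      exact hi μ (by linear_combination -hμ)
  · obtain ⟨p, hp, s, hs, hspan⟩ := exists_quadratic_extension hd
    have hind : ∀ x y : k, algebraMap k (AdjoinRoot p) x + algebraMap k (AdjoinRoot p) y * s = 0 →
        x = 0 ∧ y = 0 := by
      intro x y hxy
      have hy : y = 0 := by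
        by_contra hy
        apply hd
        refine ⟨x / y, ?_⟩
        apply (algebraMap k (AdjoinRoot p)).injective
        have hy' : algebraMap k (AdjoinRoot p) y ≠ 0 := by simpa using hy
        rw [← hs, map_mul, map_div₀]
        have hx : algebraMap k (AdjoinRoot p) x = -(algebraMap k (AdjoinRoot p) y * s) := by
          linear_combination hxy
        rw [hx]
        field_simp
      subst hy
      simpa using hxy
    have hsq : ∀ x y : k,
        IsSquare (algebraMap k (AdjoinRoot p) x + algebraMap k (AdjoinRoot p) y * s) →
        ∃ a b : k, a ^ 2 - c * b ^ 2 = x ∧ 2 * a * b = y := by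
      rintro x y ⟨z, hz⟩
      obtain ⟨a, b, rfl⟩ := hspan z
      obtain ⟨h1, h3⟩ := hind (a ^ 2 - c * b ^ 2 - x) (2 * a * b - y) (by
        rw [map_neg] at hs
        simp only [map_sub, map_mul, map_pow, map_ofNat]
        linear_combination -hz - (algebraMap k (AdjoinRoot p) b) ^ 2 * hs)
      exact ⟨a, b, sub_eq_zero.mp h1, sub_eq_zero.mp h3⟩
    have key : ∀ a b : k, a ^ 2 - c * b ^ 2 = 0 → b = 0 := by
      intro a b h
      by_contra hb
      apply hc (a / b)
      field_simp
      linear_combination h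
    have h2' : (2 : AdjoinRoot p) ≠ 0 := by
      rw [← map_ofNat (algebraMap k (AdjoinRoot p)) 2]
      simpa using h2
    have hs2 : algebraMap k (AdjoinRoot p) (1 / 2) * s = s / 2 := by
      rw [map_div₀, map_one, map_ofNat]
      ring
    refine ⟨AdjoinRoot p, inferInstance, inferInstance, s / 2, ?_, ?_, ?_, ?_⟩
    · rw [map_neg] at hs
      field_simp
      linear_combination 4 * hs
    · intro h
      obtain ⟨a, b, h3, h4⟩ := hsq 0 (1 / 2) (by rwa [map_zero, zero_add, hs2])
      rw [key a b h3] at h4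
      simp [h2.symm] at h4
    · intro h
      obtain ⟨a, b, h3, h4⟩ := hsq 0 (-(1 / 2)) (by
        rwa [map_zero, zero_add, map_neg, neg_mul, hs2])
      rw [key a b h3] at h4
      simp [h2] at h4
    · intro h
      obtain ⟨a, b, h3, h4⟩ := hsq (-1) 0 (by simpa using h)
      rcases mul_eq_zero.mp h4 with h5 | rfl
      · have ha : a = 0 := by simpa [h2] using h5
        subst ha
        have hb : b ≠ 0 := by rintro rfl; simp at h3
        apply hc (1 / b)
        field_simp
        linear_combination h3
      · exact hi a (by linear_combination h3)

/-- Rational extensions are retract rational. -/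
theorem IsRational.isRetractRational {k K : Type*} [Field k] [Field K] [Algebra k K]
    (h : IsRational k K) : IsRetractRational k K := by
  obtain ⟨n, ⟨τ⟩⟩ := h
  let g : MvPolynomial (Fin n) k →ₐ[k] K := (τ.symm : _ →ₐ[k] K).comp
    (IsScalarTower.toAlgHom k (MvPolynomial (Fin n) k) (FractionRing (MvPolynomial (Fin n) k)))
  have hg : Function.Injective g := τ.symm.injective.comp (IsFractionRing.injective _ _)
  let ε := AlgEquiv.ofInjective g hg
  let δ := (IsLocalization.atOne (MvPolynomial (Fin n) k)
    (Localization.Away (1 : MvPolynomial (Fin n) k))).restrictScalars k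
  refine ⟨g.range, ?_, n, 1, one_ne_zero, δ.toAlgHom.comp ε.symm.toAlgHom,
    ε.toAlgHom.comp δ.symm.toAlgHom, ?_⟩
  · refine IsFractionRing.of_field _ _ fun z ↦ ?_
    obtain ⟨p, q, -, hpq⟩ := IsFractionRing.div_surjective (A := MvPolynomial (Fin n) k) (τ z)
    refine ⟨ε p, ε q, ?_⟩
    rw [← τ.symm_apply_apply z, ← hpq, map_div₀]
    rfl
  · ext x
    simp

/-- **Kang.** Let `k` be a field, `c ∈ kˣ`, and `σ` the `k`-automorphism of `k(x₁,x₂,x₃)` with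
`σ(x₁) = x₂`, `σ(x₂) = x₃`, `σ(x₃) = c/(x₁x₂x₃)`. Then `k(x₁,x₂,x₃)^⟨σ⟩` is `k`-rational iff
(i) `char k = 2`, or (ii) `c ∈ k²`, or (iii) `-4c ∈ k⁴`, or (iv) `-1 ∈ k²`; moreover if it is
not `k`-rational then it is not retract `k`-rational. -/
theorem kang_C4_monomial
    (k : Type*) [Field k] (c : k) (hc : c ≠ 0)
    (σ : FractionRing (MvPolynomial (Fin 3) k) ≃ₐ[k] FractionRing (MvPolynomial (Fin 3) k))
    (hσ1 : σ (algebraMap (MvPolynomial (Fin 3) k) _ (X 0)) =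
      algebraMap (MvPolynomial (Fin 3) k) _ (X 1))
    (hσ2 : σ (algebraMap (MvPolynomial (Fin 3) k) _ (X 1)) =
      algebraMap (MvPolynomial (Fin 3) k) _ (X 2))
    (hσ3 : σ (algebraMap (MvPolynomial (Fin 3) k) _ (X 2)) =
      algebraMap k _ c *
        (algebraMap (MvPolynomial (Fin 3) k) _ (X 0) *
         algebraMap (MvPolynomial (Fin 3) k) _ (X 1) *
         algebraMap (MvPolynomial (Fin 3) k) _ (X 2))⁻¹) :
    (IsRational k (IntermediateField.fixedField (Subgroup.zpowers σ)) ↔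
      (ringChar k = 2 ∨ (∃ d : k, d ^ 2 = c) ∨ (∃ d : k, d ^ 4 = -4 * c) ∨
        (∃ d : k, d ^ 2 = -1))) ∧
    (¬ IsRational k (IntermediateField.fixedField (Subgroup.zpowers σ)) →
      ¬ IsRetractRational k (IntermediateField.fixedField (Subgroup.zpowers σ))) := by
  have h := IsMonomialC4.of_map hc (algebraicIndependent_algebraMap_X k) (adjoin_algebraMap_X k)
    hσ1 hσ2 hσ3
  have hrat : (ringChar k = 2 ∨ (∃ d : k, d ^ 2 = c) ∨ (∃ d : k, d ^ 4 = -4 * c) ∨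
      (∃ d : k, d ^ 2 = -1)) →
      IsRational k (IntermediateField.fixedField (Subgroup.zpowers σ)) := by
    intro hcond
    by_cases hk : ringChar k = 2
    · exact h.isRational_of_ringChar hc hk
    · rcases hcond with h' | ⟨d, hd⟩ | ⟨d, hd⟩ | ⟨d, hd⟩
      · exact absurd h' hk
      · exact h.isRational_of_sq_eq hc hk hd
      · exact h.isRational_of_pow_four_eq hc hk hd
      · exact h.isRational_of_sq_eq_neg_one hc hk hd
  have hretract : ¬ (ringChar k = 2 ∨ (∃ d : k, d ^ 2 = c) ∨ (∃ d : k, d ^ 4 = -4 * c) ∨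
      (∃ d : k, d ^ 2 = -1)) →
      ¬ IsRetractRational k (IntermediateField.fixedField (Subgroup.zpowers σ)) := by
    intro hcond
    push Not at hcond
    obtain ⟨hk, hc2, hc4, hi⟩ := hcond
    obtain ⟨k', _, _, e, hce, he, he', h1⟩ :=
      exists_extension_not_isSquare (Ring.two_ne_zero hk) hc2 hc4 hi
    obtain ⟨σ', h'⟩ := IsMonomialC4.exists_algEquiv (k := k') (c := algebraMap k k' c)
      (by simpa using hc) (algebraicIndependent_algebraMap_X k') (adjoin_algebraMap_X k')
    exact h.not_isRetractRational h' hce he he' h1 hc hk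
  refine ⟨⟨fun hr ↦ ?_, hrat⟩, fun hr ↦ hretract fun hcond ↦ hr (hrat hcond)⟩
  by_contra hcond
  exact hretract hcond hr.isRetractRational
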